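/- arXiv:2406.13998 — 3 statements merged into one kernel-verified Lean document; each statement's English description precedes it below -/
import Mathlib

section
/- Let V be a set of n vertices and let G = {G_1, ..., G_{n-1}} be a collection of (not necessarily distinct) graphs on the common vertex set V. If every graph G_i satisfies δ(G_i) ≥ (n-1)/2, then G contains a transversal Hamilton path, i.e., a Hamilton path P on V together with a bijection φ from E(P) to {1,...,n-1} such that each edge e of P belongs to E(G_{φ(e)}). -/
open SimpleGraph

/-- A transversal Hamilton path in a collection of `m` graphs on `V`. -/
def HasTransHamPath {V : Type*} [DecidableEq V] {m : ℕ} (Gs : Fin m → SimpleGraph V) : Prop :=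
  ∃ (u v : V) (p : (⊤ : SimpleGraph V).Walk u v),
    p.IsHamiltonian ∧
      ∃ φ : Fin p.edges.length ≃ Fin m, ∀ i, p.edges.get i ∈ (Gs (φ i)).edgeSet

/-- Degree of `v` in `G`, without decidability assumptions. -/
noncomputable def deg {V : Type*} (G : SimpleGraph V) (v : V) : ℕ :=
  (G.neighborSet v).ncard

/-- Rainbow path on exactly the vertex set `S` using exactly the colours `C`. -/
inductive RP {V κ : Type*} [DecidableEq V] [DecidableEq κ] (Gs : κ → SimpleGraph V) :
    Finset V → Finset κ → V → V → Prop
  | single (v : V) : RP Gs {v} ∅ v v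
  | cons {S : Finset V} {C : Finset κ} {a b : V} (v : V) (c : κ) (hv : v ∉ S) (hc : c ∉ C)
      (hadj : (Gs c).Adj v a) (h : RP Gs S C a b) : RP Gs (insert v S) (insert c C) v b

namespace RP

variable {V κ : Type*} [DecidableEq V] [DecidableEq κ] {Gs : κ → SimpleGraph V}

lemma left_mem {S C a b} (h : RP Gs S C a b) : a ∈ S := by
  cases h <;> simp

lemma right_mem {S C a b} (h : RP Gs S C a b) : b ∈ S := by
  induction h with
  | single v => simp
  | cons v c hv hc hadj h ih => simp [ih]

lemma card_eq {S C a b} (h : RP Gs S C a b) : S.card = C.card + 1 := by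
  induction h with
  | single v => simp
  | cons v c hv hc hadj h ih =>
    rw [Finset.card_insert_of_notMem hv, Finset.card_insert_of_notMem hc, ih]

lemma append {S C a b S' C' a' b'} (h : RP Gs S C a b) (h' : RP Gs S' C' a' b') (c : κ)
    (hS : Disjoint S S') (hC : Disjoint C C') (hc : c ∉ C) (hc' : c ∉ C')
    (hadj : (Gs c).Adj b a') : RP Gs (S ∪ S') (insert c (C ∪ C')) a b' := by
  induction h with
  | single v =>
    have := RP.cons v c (by simpa using hS) hc' hadj h'
    rw [Finset.empty_union, ← Finset.insert_eq]
    exact this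
  | @cons S C a b v d hv hd hadj' h ih =>
    rw [Finset.disjoint_insert_left] at hS hC
    simp only [Finset.mem_insert, not_or] at hc
    have := RP.cons v d (S := S ∪ S') (C := insert c (C ∪ C')) (by simp [hv, hS.1])
      (by simp only [Finset.mem_insert, Finset.mem_union, not_or]
          exact ⟨fun h => hc.1 h.symm, hd, hC.1⟩) hadj'
      (ih hS.2 hC.2 hc.2 hadj)
    rw [Finset.insert_union, Finset.insert_union, Finset.insert_comm]
    exact this

lemma symm {S C a b} (h : RP Gs S C a b) : RP Gs S C b a := by
  induction h with
  | single v => exact .single v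
  | @cons S C a b v d hv hd hadj' h ih =>
    have := ih.append (.single v) d (by simpa using hv) (by simp) hd (by simp) hadj'.symm
    convert this using 1
    · ext; simp
    · simp

/-- Splitting of a path at an edge. -/
lemma split {S C a b} (h : RP Gs S C a b) (c0 : κ) : ∃ (x : ℕ → V) (col : ℕ → κ),
    x 0 = a ∧ x C.card = b ∧
    (∀ y ∈ S, y ≠ b → ∃ m < C.card, x m = y) ∧
    (∀ y ∈ S, y ≠ a → ∃ m < C.card, x (m + 1) = y) ∧
    (∀ c ∈ C, ∃ m < C.card, col m = c) ∧
    (∀ m ≤ C.card, x m ∈ S) ∧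
    (∀ m < C.card, col m ∈ C) ∧
    (∀ m ≤ C.card, ∀ m' ≤ C.card, x m = x m' → m = m') ∧
    (∀ m < C.card, ∀ m' < C.card, col m = col m' → m = m') ∧
    (∀ m < C.card, ∃ S1 S2 C1 C2, RP Gs S1 C1 a (x m) ∧ RP Gs S2 C2 (x (m + 1)) b ∧
      Disjoint S1 S2 ∧ S1 ∪ S2 = S ∧ Disjoint C1 C2 ∧ col m ∉ C1 ∧ col m ∉ C2 ∧
      insert (col m) (C1 ∪ C2) = C ∧ (Gs (col m)).Adj (x m) (x (m + 1))) := by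
  induction h with
  | single v =>
    exact ⟨fun _ => v, fun _ => c0, by simp⟩
  | @cons S C a b v c hv hc hadj h ih =>
    obtain ⟨x, col, h0, h1, h2, h3, h4, h5, h6, h7, h8, h9⟩ := ih
    have hcard : (insert c C).card = C.card + 1 := Finset.card_insert_of_notMem hc
    refine ⟨fun m => Nat.casesOn m v x, fun m => Nat.casesOn m c col, rfl, ?_, ?_, ?_, ?_, ?_, ?_,
      ?_, ?_, ?_⟩ <;> rw [hcard]
    · exact h1
    · intro y hy hyb
      rcases Finset.mem_insert.1 hy with rfl | hy
      · exact ⟨0, by omega, rfl⟩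
      · obtain ⟨m, hm, rfl⟩ := h2 y hy hyb
        exact ⟨m + 1, by omega, rfl⟩
    · intro y hy hyb
      rcases Finset.mem_insert.1 hy with rfl | hy
      · exact absurd rfl hyb
      · by_cases hya : y = a
        · exact ⟨0, by omega, by simp [h0, hya]⟩
        · obtain ⟨m, hm, rfl⟩ := h3 y hy hya
          exact ⟨m + 1, by omega, rfl⟩
    · intro y hy
      rcases Finset.mem_insert.1 hy with rfl | hy
      · exact ⟨0, by omega, rfl⟩
      · obtain ⟨m, hm, rfl⟩ := h4 y hy
        exact ⟨m + 1, by omega, rfl⟩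
    · rintro (_ | m) hm
      · simp
      · exact Finset.mem_insert_of_mem (h5 m (by omega))
    · rintro (_ | m) hm
      · simp
      · exact Finset.mem_insert_of_mem (h6 m (by omega))
    · rintro (_ | m) hm (_ | m') hm' heq
      · rfl
      · exact absurd ((show v = x m' from heq) ▸ h5 m' (by omega)) hv
      · exact absurd ((show x m = v from heq) ▸ h5 m (by omega)) hv
      · rw [h7 m (by omega) m' (by omega) heq]
    · rintro (_ | m) hm (_ | m') hm' heq
      · rfl
      · exact absurd ((show c = col m' from heq) ▸ h6 m' (by omega)) hc
      · exact absurd ((show col m = c from heq) ▸ h6 m (by omega)) hc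
      · rw [h8 m (by omega) m' (by omega) heq]
    · rintro (_ | m) hm
      · refine ⟨{v}, S, ∅, C, .single v, ?_, by simpa using hv, (Finset.insert_eq v S).symm,
          by simp, by simp, hc, by simp, ?_⟩
        · simpa [h0] using h
        · simpa [h0] using hadj
      · obtain ⟨S1, S2, C1, C2, r1, r2, d1, rfl, d2, c1, c2, rfl, ad⟩ := h9 m (by omega)
        simp only [Finset.mem_union, Finset.mem_insert, not_or] at hv hc
        refine ⟨insert v S1, S2, insert c C1, C2, .cons v c hv.1 hc.2.1 hadj r1, r2,
          ?_, ?_, ?_, ?_, c2, ?_, ad⟩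
        · rw [Finset.disjoint_insert_left]; exact ⟨hv.2, d1⟩
        · rw [Finset.insert_union]
        · rw [Finset.disjoint_insert_left]; exact ⟨hc.2.2, d2⟩
        · simp only [Finset.mem_insert, not_or]; exact ⟨fun h => hc.1 h.symm, c1⟩
        · rw [Finset.insert_union, Finset.insert_comm]

/-- Opening a rainbow cycle at any vertex. -/
lemma reopen {S C a b} (h : RP Gs S C a b) (c : κ) (hc : c ∉ C) (hadj : (Gs c).Adj b a)
    (y : V) (hy : y ∈ S) : ∃ z C', RP Gs S C' y z ∧ C' ⊆ insert c C := by
  by_cases hya : y = a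
  · exact ⟨b, C, hya ▸ h, Finset.subset_insert _ _⟩
  obtain ⟨x, col, h0, h1, h2, h3, h4, h5, h6, h7, h8, h9⟩ := h.split c
  obtain ⟨m, hm, rfl⟩ := h3 y hy hya
  obtain ⟨S1, S2, C1, C2, r1, r2, d1, rfl, d2, c1, c2, rfl, ad⟩ := h9 m hm
  simp only [Finset.mem_union, Finset.mem_insert, not_or] at hc
  refine ⟨x m, _, Finset.union_comm S2 S1 ▸ r2.append r1 c d1.symm d2.symm hc.2.2 hc.2.1 hadj, ?_⟩
  intro d; simp; tauto

/-- Conversion to a walk. -/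
lemma toWalk {S C a b} (h : RP Gs S C a b) : ∃ (p : (⊤ : SimpleGraph V).Walk a b) (cs : List κ),
    p.support.Nodup ∧ p.support.toFinset = S ∧ cs.Nodup ∧ cs.toFinset = C ∧
    List.Forall₂ (fun e c => e ∈ (Gs c).edgeSet) p.edges cs := by
  induction h with
  | single v => exact ⟨.nil, [], by simp⟩
  | @cons S C a b v c hv hc hadj h ih =>
    obtain ⟨p, cs, h1, rfl, h3, rfl, h5⟩ := ih
    refine ⟨.cons (by simpa using hadj.ne) p, c :: cs, ?_, by simp, ?_, by simp, ?_⟩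
    · simpa using ⟨by simpa using hv, h1⟩
    · simpa using ⟨by simpa using hc, h3⟩
    · simpa using ⟨hadj, h5⟩

end RP

section main
variable {V κ : Type*} [DecidableEq V] [DecidableEq κ] [Fintype V] [Fintype κ]
  {Gs : κ → SimpleGraph V}

open Classical in
/-- Neighbour finset. -/
noncomputable def nb (Gs : κ → SimpleGraph V) (c : κ) (v : V) : Finset V :=
  Finset.univ.filter fun u => (Gs c).Adj v u

lemma mem_nb {c : κ} {v u : V} : u ∈ nb Gs c v ↔ (Gs c).Adj v u := by simp [nb]

lemma exists_long (hV : Fintype.card V = Fintype.card κ + 1)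
    (hdeg : ∀ c v, Fintype.card κ ≤ 2 * (nb Gs c v).card) (k : ℕ) (hk : k + 1 ≤ Fintype.card κ) :
    ∃ S C a b, RP Gs S C a b ∧ S.card = k + 1 := by
  classical
  induction k with
  | zero =>
    have : Nonempty V := Fintype.card_pos_iff.1 (by omega)
    obtain ⟨v⟩ := this
    exact ⟨_, _, _, _, .single v, by simp⟩
  | succ k ih =>
    obtain ⟨S, C, a, b, h, hS⟩ := ih (by omega)
    by_contra hcon
    have hmax : ∀ C' a' b', RP Gs S C' a' b' → ∀ f ∉ C', ∀ w, (Gs f).Adj a' w → w ∈ S := by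
      intro C' a' b' h' f hf w hw
      by_contra hwS
      exact hcon ⟨_, _, _, _, .cons w f hwS hf hw.symm h',
        by rw [Finset.card_insert_of_notMem hwS, hS]⟩
    have hC := h.card_eq
    have : 1 < Cᶜ.card := by rw [Finset.card_compl]; omega
    obtain ⟨c, hc, d, hd, hcd⟩ := Finset.one_lt_card.1 this
    rw [Finset.mem_compl] at hc hd
    obtain ⟨x, col, h0, h1, h2, h3, h4, h5, h6, h7, h8, h9⟩ := h.split c
    set P1 := (Finset.range C.card).filter fun m => (Gs c).Adj a (x (m + 1)) with hP1
    set P2 := (Finset.range C.card).filter fun m => (Gs d).Adj b (x m) with hP2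
    have hc1 : (nb Gs c a).card ≤ P1.card := by
      refine (Finset.card_le_card (t := P1.image fun m => x (m + 1)) ?_).trans
        Finset.card_image_le
      intro u hu
      rw [mem_nb] at hu
      obtain ⟨m, hm, rfl⟩ := h3 u (hmax _ _ _ h c hc u hu) hu.ne'
      exact Finset.mem_image.2 ⟨m, by simp [hP1, hm, hu], rfl⟩
    have hc2 : (nb Gs d b).card ≤ P2.card := by
      refine (Finset.card_le_card (t := P2.image fun m => x m) ?_).trans
        Finset.card_image_le
      intro u hu
      rw [mem_nb] at hu
      obtain ⟨m, hm, rfl⟩ := h2 u (hmax _ _ _ h.symm d hd u hu) hu.ne'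
      exact Finset.mem_image.2 ⟨m, by simp [hP2, hm, hu], rfl⟩
    have e1 := hdeg c a
    have e2 := hdeg d b
    have hsub : P1 ∪ P2 ⊆ Finset.range C.card :=
      Finset.union_subset (Finset.filter_subset _ _) (Finset.filter_subset _ _)
    have hcu := Finset.card_le_card hsub
    have hui := Finset.card_union_add_card_inter P1 P2
    rw [Finset.card_range] at hcu
    have hpos : 0 < (P1 ∩ P2).card := by omega
    obtain ⟨m, hm⟩ := Finset.card_pos.1 hpos
    simp only [hP1, hP2, Finset.mem_inter, Finset.mem_filter, Finset.mem_range] at hm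
    obtain ⟨⟨hmC, ha⟩, -, hb⟩ := hm
    obtain ⟨S1, S2, C1, C2, r1, r2, d1, hSS, d2, c1, c2, hCC, ad⟩ := h9 m hmC
    have hd' := hd
    have hc' := hc
    rw [← hCC] at hd' hc'
    simp only [Finset.mem_union, Finset.mem_insert, not_or] at hc' hd'
    have q := r1.append r2.symm d d1 d2 hd'.2.1 hd'.2.2 hb.symm
    rw [hSS] at q
    have hcq : c ∉ insert d (C1 ∪ C2) := by simp [hc', hcd]
    have : 0 < Sᶜ.card := by rw [Finset.card_compl]; omega
    obtain ⟨w, hw⟩ := Finset.card_pos.1 this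
    have hsub : nb Gs (col m) w ⊆ Sᶜ.erase w := by
      intro u hu
      rw [mem_nb] at hu
      rw [Finset.mem_erase, Finset.mem_compl]
      refine ⟨hu.ne', fun huS => ?_⟩
      obtain ⟨z, C', r, hC'⟩ := q.reopen c hcq ha.symm u huS
      have : col m ∉ C' := by
        intro hx
        have := hC' hx
        simp only [Finset.mem_union, Finset.mem_insert] at this
        rcases this with h | h | h | h
        · exact hc'.1 h.symm
        · exact hd'.1 h.symm
        · exact c1 h
        · exact c2 h
      exact Finset.mem_compl.1 hw (hmax _ _ _ r _ this w hu.symm)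
    have := Finset.card_le_card hsub
    rw [Finset.card_erase_of_mem hw, Finset.card_compl] at this
    have e3 := hdeg (col m) w
    have : P1.card ≤ C.card := by simpa using Finset.card_filter_le (Finset.range C.card) _
    omega

open Classical in
/-- Vertices that are not ends of a rainbow path missing only `w`. -/
noncomputable def Rset (Gs : κ → SimpleGraph V) (w : V) : Finset V :=
  Finset.univ.filter fun l => l ≠ w ∧ ∀ i e', ¬ RP Gs {w}ᶜ {i}ᶜ l e'

open Classical in
/-- Colours of the pair `w l`. -/
noncomputable def Kset (Gs : κ → SimpleGraph V) (w l : V) : Finset κ :=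
  Finset.univ.filter fun c => (Gs c).Adj w l

lemma mem_Kset {c : κ} {v u : V} : c ∈ Kset Gs v u ↔ (Gs c).Adj v u := by simp [Kset]

lemma compl_aux {α : Type*} [Fintype α] [DecidableEq α] {i j : α} {C1 C2 : Finset α}
    (h : insert j (C1 ∪ C2) = {i}ᶜ) (h1 : j ∉ C1) (h2 : j ∉ C2) :
    insert i (C1 ∪ C2) = {j}ᶜ ∧ i ∉ C1 ∧ i ∉ C2 ∧ i ≠ j := by
  have h' : ∀ x, (x = j ∨ x ∈ C1 ∨ x ∈ C2) ↔ x ≠ i := by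
    intro x
    have := Finset.ext_iff.1 h x
    simpa using this
  have hi := h' i
  refine ⟨?_, by tauto, by tauto, by tauto⟩
  ext x
  have hx := h' x
  simp only [Finset.mem_insert, Finset.mem_union, Finset.mem_compl, Finset.mem_singleton]
  by_cases x = i <;> by_cases hxj : x = j <;> try subst hxj
  all_goals tauto

/-- Rotation. -/
lemma rot {w : V} {i : κ} {e e' : V} (h : RP Gs {w}ᶜ {i}ᶜ e e') {j : κ} {u v : V}
    {S1 S2 C1 C2} (r1 : RP Gs S1 C1 e u) (r2 : RP Gs S2 C2 v e') (d1 : Disjoint S1 S2)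
    (hS : S1 ∪ S2 = {w}ᶜ) (d2 : Disjoint C1 C2) (c1 : j ∉ C1) (c2 : j ∉ C2)
    (hC : insert j (C1 ∪ C2) = {i}ᶜ) (hadj : (Gs i).Adj e' u) :
    RP Gs {w}ᶜ {j}ᶜ e v := by
  obtain ⟨q1, q2, q3, q4⟩ := compl_aux hC c1 c2
  have := r1.append r2.symm i d1 d2 q2 q3 hadj.symm
  rwa [hS, q1] at this

lemma ext_false (hno : ∀ a b, ¬ RP Gs Finset.univ Finset.univ a b) {w : V} {i : κ} {e e' : V}
    (h : RP Gs {w}ᶜ {i}ᶜ e e') : ¬ (Gs i).Adj w e := by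
  intro hadj
  have := RP.cons w i (by simp) (by simp) hadj h
  refine hno w e' ?_
  convert this using 1
  · ext x; simp
  · ext x; simp

lemma bound (hV : Fintype.card V = Fintype.card κ + 1)
    (hdeg : ∀ c v, Fintype.card κ ≤ 2 * (nb Gs c v).card)
    (hno : ∀ a b, ¬ RP Gs Finset.univ Finset.univ a b) {w : V} {i : κ} {e e' : V}
    (h : RP Gs {w}ᶜ {i}ᶜ e e') :
    2 * (Kset Gs w e).card + 2 * (Rset Gs w ∩ nb Gs i w).card + 2 ≤ Fintype.card κ := by
  classical
  have hie := ext_false hno h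
  have hie' := ext_false hno h.symm
  obtain ⟨x, col, h0, h1, h2, h3, h4, h5, h6, h7, h8, h9⟩ := h.split i
  have hk : ({i}ᶜ : Finset κ).card = Fintype.card κ - 1 := by simp [Finset.card_compl]
  have hκ : 0 < Fintype.card κ := Fintype.card_pos_iff.2 ⟨i⟩
  rw [hk] at h1 h2 h3 h4 h5 h6 h7 h8 h9
  set k := Fintype.card κ - 1 with hkdef
  set P1 := (Finset.range k).filter fun m => (Gs i).Adj e' (x m) with hP1
  set P2 := (Finset.range k).filter fun m => x (m + 1) ∈ Rset Gs w ∩ nb Gs i w with hP2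
  set P3 := (Finset.range k).filter fun m => col m ∈ Kset Gs w e with hP3
  have a1 : (nb Gs i e').card ≤ P1.card := by
    refine (Finset.card_le_card (t := P1.image x) ?_).trans Finset.card_image_le
    intro u hu
    rw [mem_nb] at hu
    have huw : u ≠ w := by rintro rfl; exact hie' hu.symm
    obtain ⟨m, hm, rfl⟩ := h2 u (by simpa using huw) hu.ne'
    exact Finset.mem_image.2 ⟨m, by simp [hP1, hm, hu], rfl⟩
  have a2 : (Rset Gs w ∩ nb Gs i w).card ≤ P2.card := by
    refine (Finset.card_le_card (t := P2.image fun m => x (m + 1)) ?_).trans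
      Finset.card_image_le
    intro u hu
    have hu1 := (Finset.mem_inter.1 hu).1
    simp only [Rset, Finset.mem_filter] at hu1
    have hue : u ≠ e := by rintro rfl; exact hu1.2.2 _ _ h
    obtain ⟨m, hm, rfl⟩ := h3 u (by simpa using hu1.2.1) hue
    exact Finset.mem_image.2 ⟨m, Finset.mem_filter.2 ⟨Finset.mem_range.2 hm, hu⟩, rfl⟩
  have a3 : (Kset Gs w e).card ≤ P3.card := by
    refine (Finset.card_le_card (t := P3.image col) ?_).trans Finset.card_image_le
    intro c hc
    have hci : c ≠ i := by rintro rfl; exact hie (mem_Kset.1 hc)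
    obtain ⟨m, hm, rfl⟩ := h4 c (by simpa using hci)
    exact Finset.mem_image.2 ⟨m, Finset.mem_filter.2 ⟨Finset.mem_range.2 hm, hc⟩, rfl⟩
  have d12 : Disjoint P1 P2 := by
    rw [Finset.disjoint_left]
    intro m hm1 hm2
    simp only [hP1, hP2, Finset.mem_filter, Finset.mem_range, Finset.mem_inter] at hm1 hm2
    obtain ⟨S1, S2, C1, C2, r1, r2, d1, hS, d2, c1, c2, hC, ad⟩ := h9 m hm1.1
    have := rot h r1 r2 d1 hS d2 c1 c2 hC hm1.2
    have hR := hm2.2.1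
    simp only [Rset, Finset.mem_filter] at hR
    exact hR.2.2 _ _ this.symm
  have d13 : Disjoint P1 P3 := by
    rw [Finset.disjoint_left]
    intro m hm1 hm2
    simp only [hP1, hP3, Finset.mem_filter, Finset.mem_range] at hm1 hm2
    obtain ⟨S1, S2, C1, C2, r1, r2, d1, hS, d2, c1, c2, hC, ad⟩ := h9 m hm1.1
    have := rot h r1 r2 d1 hS d2 c1 c2 hC hm1.2
    exact ext_false hno this (mem_Kset.1 hm2.2)
  have d23 : Disjoint P2 P3 := by
    rw [Finset.disjoint_left]
    intro m hm1 hm2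
    simp only [hP2, hP3, Finset.mem_filter, Finset.mem_range, Finset.mem_inter] at hm1 hm2
    obtain ⟨S1, S2, C1, C2, r1, r2, d1, hS, d2, c1, c2, hC, ad⟩ := h9 m hm1.1
    obtain ⟨q1, q2, q3, q4⟩ := compl_aux hC c1 c2
    have hwS : w ∉ S1 ∪ S2 := by rw [hS]; simp
    simp only [Finset.mem_union, not_or] at hwS
    have t1 := RP.cons w i hwS.2 q3 (mem_nb.1 hm1.2.2) r2
    have t2 := r1.symm.append t1 (col m)
      (by rw [Finset.disjoint_insert_right]; exact ⟨hwS.1, d1⟩)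
      (by rw [Finset.disjoint_insert_right]; exact ⟨q2, d2⟩) c1
      (by simp only [Finset.mem_insert, not_or]; exact ⟨fun h => q4 h.symm, c2⟩)
      (mem_Kset.1 hm2.2).symm
    refine hno _ _ (?_ : RP Gs _ _ (x m) e')
    convert t2 using 1
    · rw [Finset.union_insert, hS]; ext y; simp
    · rw [Finset.union_insert, q1]; ext y; simp
  have hsub : (P1 ∪ P2) ∪ P3 ⊆ Finset.range k :=
    Finset.union_subset (Finset.union_subset (Finset.filter_subset _ _) (Finset.filter_subset _ _))
      (Finset.filter_subset _ _)
  have hcu := Finset.card_le_card hsub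
  rw [Finset.card_range, Finset.card_union_of_disjoint (Finset.disjoint_union_left.2 ⟨d13, d23⟩),
    Finset.card_union_of_disjoint d12] at hcu
  have := hdeg i e'
  omega

lemma final (hV : Fintype.card V = Fintype.card κ + 1)
    (hdeg : ∀ c v, Fintype.card κ ≤ 2 * (nb Gs c v).card)
    (hno : ∀ a b, ¬ RP Gs Finset.univ Finset.univ a b) {w : V} {i : κ} {e e' : V}
    (h : RP Gs {w}ᶜ {i}ᶜ e e') : False := by
  classical
  have hκ : 0 < Fintype.card κ := Fintype.card_pos_iff.2 ⟨i⟩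
  -- the family of ends with distinct free colours
  obtain ⟨Q, hQ1, hQ2, hQ3, hQ4⟩ : ∃ Q : Finset (κ × V),
      Set.InjOn Prod.fst (Q : Set (κ × V)) ∧ Set.InjOn Prod.snd (Q : Set (κ × V)) ∧
      (∀ q ∈ Q, ∃ z, RP Gs {w}ᶜ {q.1}ᶜ q.2 z) ∧ Fintype.card κ + 2 ≤ 2 * Q.card := by
    have hie' := ext_false hno h.symm
    obtain ⟨x, col, h0, h1, h2, h3, h4, h5, h6, h7, h8, h9⟩ := h.split i
    set k := ({i}ᶜ : Finset κ).card with hkdef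
    set P1 := (Finset.range k).filter fun m => (Gs i).Adj e' (x m) with hP1
    have a1 : (nb Gs i e').card ≤ P1.card := by
      refine (Finset.card_le_card (t := P1.image x) ?_).trans Finset.card_image_le
      intro u hu
      rw [mem_nb] at hu
      have huw : u ≠ w := by rintro rfl; exact hie' hu.symm
      obtain ⟨m, hm, rfl⟩ := h2 u (by simpa using huw) hu.ne'
      exact Finset.mem_image.2 ⟨m, by simp [hP1, hm, hu], rfl⟩
    have hP : ∀ m ∈ P1, m < k ∧ (Gs i).Adj e' (x m) := by
      intro m hm; simpa [hP1] using hm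
    have hcoli : ∀ m < k, col m ≠ i := fun m hm => by simpa using h6 m hm
    have hxe : ∀ m < k, x (m + 1) ≠ e := fun m hm hh => by
      have := h7 (m + 1) (by omega) 0 (by omega) (hh.trans h0.symm)
      omega
    refine ⟨insert (i, e) (P1.image fun m => (col m, x (m + 1))), ?_, ?_, ?_, ?_⟩
    · intro p hp q hq hpq
      simp only [Finset.coe_insert, Finset.coe_image, Set.mem_insert_iff, Set.mem_image,
        Finset.mem_coe] at hp hq
      rcases hp with rfl | ⟨m, hm, rfl⟩ <;> rcases hq with rfl | ⟨m', hm', rfl⟩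
      · rfl
      · exact absurd hpq.symm (hcoli m' (hP m' hm').1)
      · exact absurd hpq (hcoli m (hP m hm).1)
      · rw [h8 m (hP m hm).1 m' (hP m' hm').1 hpq]
    · intro p hp q hq hpq
      simp only [Finset.coe_insert, Finset.coe_image, Set.mem_insert_iff, Set.mem_image,
        Finset.mem_coe] at hp hq
      rcases hp with rfl | ⟨m, hm, rfl⟩ <;> rcases hq with rfl | ⟨m', hm', rfl⟩
      · rfl
      · exact absurd hpq.symm (hxe m' (hP m' hm').1)
      · exact absurd hpq (hxe m (hP m hm).1)
      · have := (hP m hm).1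
        have := (hP m' hm').1
        have := h7 (m + 1) (by omega) (m' + 1) (by omega) hpq
        rw [Nat.succ_injective this]
    · intro q hq
      simp only [Finset.mem_insert, Finset.mem_image] at hq
      rcases hq with rfl | ⟨m, hm, rfl⟩
      · exact ⟨e', h⟩
      · obtain ⟨S1, S2, C1, C2, r1, r2, d1, hS, d2, c1, c2, hC, ad⟩ := h9 m (hP m hm).1
        exact ⟨e, (rot h r1 r2 d1 hS d2 c1 c2 hC (hP m hm).2).symm⟩
    · rw [Finset.card_insert_of_notMem, Finset.card_image_of_injOn]
      · have := hdeg i e'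
        omega
      · intro m hm m' hm' hh
        exact h8 m (hP m hm).1 m' (hP m' hm').1 (congrArg Prod.fst hh)
      · intro hh
        obtain ⟨m, hm, hh⟩ := Finset.mem_image.1 hh
        exact hcoli m (hP m hm).1 (congrArg Prod.fst hh)
  set N := Fintype.card κ with hN
  set R := Rset Gs w with hR
  set F := Q.image Prod.fst with hF
  set E0 := Q.image Prod.snd with hE0
  have hFc : F.card = Q.card := Finset.card_image_of_injOn hQ1
  have hE0c : E0.card = Q.card := Finset.card_image_of_injOn hQ2
  set E1 := (({w}ᶜ : Finset V) \ R) \ E0 with hE1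
  have hE0sub : E0 ⊆ ({w}ᶜ : Finset V) \ R := by
    intro l hl
    obtain ⟨q, hq, rfl⟩ := Finset.mem_image.1 hl
    obtain ⟨z, hz⟩ := hQ3 q hq
    rw [Finset.mem_sdiff]
    refine ⟨hz.left_mem, fun hl => ?_⟩
    simp only [hR, Rset, Finset.mem_filter] at hl
    exact hl.2.2 _ _ hz
  have hRsub : R ⊆ ({w}ᶜ : Finset V) := by
    intro l hl
    simp only [hR, Rset, Finset.mem_filter] at hl
    simpa using hl.2.1
  have hcard : E1.card + E0.card + R.card = N := by
    have t1 := Finset.card_sdiff_add_card_eq_card hE0sub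
    have t2 := Finset.card_sdiff_add_card_eq_card hRsub
    have t3 : ({w}ᶜ : Finset V).card = N := by simp [Finset.card_compl, hV]
    rw [← hE1] at t1
    omega
  have hsum : ∑ l ∈ ({w}ᶜ : Finset V), (Kset Gs w l).card =
      ∑ l ∈ E1, (Kset Gs w l).card + ∑ l ∈ E0, (Kset Gs w l).card +
      ∑ l ∈ R, (Kset Gs w l).card := by
    rw [← Finset.sum_sdiff hRsub, ← Finset.sum_sdiff hE0sub]
  have hlow : N * N ≤ 2 * ∑ l ∈ ({w}ᶜ : Finset V), (Kset Gs w l).card := by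
    have e1 : ∑ l ∈ ({w}ᶜ : Finset V), (Kset Gs w l).card = ∑ c : κ, (nb Gs c w).card := by
      have : ∀ c : κ, (nb Gs c w).card = ∑ l ∈ ({w}ᶜ : Finset V), if (Gs c).Adj w l then 1 else 0 := by
        intro c
        rw [← Finset.card_filter]
        congr 1
        ext l
        simp only [mem_nb, Finset.mem_filter, Finset.mem_compl, Finset.mem_singleton]
        exact ⟨fun h => ⟨h.ne', h⟩, fun h => h.2⟩
      simp_rw [this]
      rw [Finset.sum_comm]
      refine Finset.sum_congr rfl fun l _ => ?_
      rw [← Finset.card_filter]; rfl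
    rw [e1, Finset.mul_sum]
    calc N * N = ∑ c : κ, N := by simp [hN]
      _ ≤ _ := Finset.sum_le_sum fun c _ => hdeg c w
  have u1 : 2 * ∑ l ∈ E1, (Kset Gs w l).card + 2 * E1.card ≤ E1.card * N := by
    have : ∑ l ∈ E1, (2 * (Kset Gs w l).card + 2) ≤ ∑ l ∈ E1, N := by
      refine Finset.sum_le_sum fun l hl => ?_
      have hl' := (Finset.mem_sdiff.1 (Finset.mem_sdiff.1 hl).1)
      have : ∃ i e', RP Gs {w}ᶜ {i}ᶜ l e' := by
        by_contra hcon
        push Not at hcon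
        exact hl'.2 (by simp only [hR, Rset, Finset.mem_filter]; exact ⟨by simp, by simpa using hl'.1, hcon⟩)
      obtain ⟨i, e', hh⟩ := this
      have := bound hV hdeg hno hh
      omega
    simp only [Finset.sum_add_distrib, ← Finset.mul_sum, Finset.sum_const, smul_eq_mul] at this
    linarith
  have u0 : 2 * ∑ l ∈ E0, (Kset Gs w l).card + 2 * ∑ c ∈ F, (R ∩ nb Gs c w).card + 2 * E0.card
      ≤ E0.card * N := by
    rw [hE0c, hE0, hF, Finset.sum_image hQ1, Finset.sum_image hQ2]
    have : ∑ q ∈ Q, (2 * (Kset Gs w q.2).card + 2 * (R ∩ nb Gs q.1 w).card + 2) ≤ ∑ q ∈ Q, N := by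
      refine Finset.sum_le_sum fun q hq => ?_
      obtain ⟨z, hz⟩ := hQ3 q hq
      exact bound hV hdeg hno hz
    simp only [Finset.sum_add_distrib, ← Finset.mul_sum, Finset.sum_const, smul_eq_mul] at this
    linarith
  have uR : 2 * ∑ l ∈ R, (Kset Gs w l).card + 2 * R.card ≤
      2 * ∑ c ∈ F, (R ∩ nb Gs c w).card + R.card * N := by
    have e1 : ∑ c ∈ F, (R ∩ nb Gs c w).card = ∑ l ∈ R, (F ∩ Kset Gs w l).card := by
      have t1 : ∀ c, (R ∩ nb Gs c w).card = ∑ l ∈ R, if (Gs c).Adj w l then 1 else 0 := by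
        intro c
        rw [← Finset.card_filter]
        congr 1
        ext l; simp [mem_nb]
      have t2 : ∀ l, (F ∩ Kset Gs w l).card = ∑ c ∈ F, if (Gs c).Adj w l then 1 else 0 := by
        intro c
        rw [← Finset.card_filter]
        congr 1
        ext l; simp [mem_Kset]
      simp_rw [t1, t2]
      exact Finset.sum_comm
    rw [e1]
    have : ∑ l ∈ R, (2 * (Kset Gs w l).card + 2) ≤ ∑ l ∈ R, (2 * (F ∩ Kset Gs w l).card + N) := by
      refine Finset.sum_le_sum fun l hl => ?_
      have t1 := Finset.card_sdiff_add_card_inter (Kset Gs w l) F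
      have t2 : (Kset Gs w l \ F).card ≤ Fᶜ.card :=
        Finset.card_le_card fun c hc => Finset.mem_compl.2 (Finset.mem_sdiff.1 hc).2
      rw [Finset.card_compl] at t2
      rw [Finset.inter_comm] at t1
      omega
    simp only [Finset.sum_add_distrib, ← Finset.mul_sum, Finset.sum_const, smul_eq_mul] at this
    linarith
  have hNN : (E1.card + E0.card + R.card) * N = N * N := by rw [hcard]
  nlinarith

lemma exists_RP (hV : Fintype.card V = Fintype.card κ + 1)
    (hdeg : ∀ c v, Fintype.card κ ≤ 2 * (nb Gs c v).card) :
    ∃ a b, RP Gs Finset.univ Finset.univ a b := by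
  classical
  by_contra hno
  push Not at hno
  rcases Nat.eq_zero_or_pos (Fintype.card κ) with h0 | hpos
  · rw [h0] at hV
    obtain ⟨v, hv⟩ := Fintype.card_eq_one_iff.1 hV
    have : IsEmpty κ := Fintype.card_eq_zero_iff.1 h0
    refine hno v v ?_
    convert RP.single (Gs := Gs) v using 1
    · ext x; simp [hv x]
    · exact Finset.univ_eq_empty
  · obtain ⟨S, C, a, b, h, hS⟩ := exists_long hV hdeg (Fintype.card κ - 1) (by omega)
    have hC := h.card_eq
    have s1 : Sᶜ.card = 1 := by rw [Finset.card_compl]; omega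
    have c1 : Cᶜ.card = 1 := by rw [Finset.card_compl]; omega
    obtain ⟨w, hw⟩ := Finset.card_eq_one.1 s1
    obtain ⟨i, hi⟩ := Finset.card_eq_one.1 c1
    rw [compl_eq_comm] at hw hi
    rw [← hw, ← hi] at h
    exact final hV hdeg hno h

end main

/-- Theorem 1: a collection of `n-1` graphs on `n` vertices with minimum degree at least
`(n-1)/2` has a transversal Hamilton path. -/
theorem stmt_0 {V : Type*} [Fintype V] [DecidableEq V] (n : ℕ) (hn : 1 ≤ n)
    (hcard : Fintype.card V = n) (Gs : Fin (n - 1) → SimpleGraph V)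
    (hdeg : ∀ i v, n - 1 ≤ 2 * deg (Gs i) v) :
    HasTransHamPath Gs := by
  classical
  have hd : ∀ c v, Fintype.card (Fin (n - 1)) ≤ 2 * (nb Gs c v).card := by
    intro c v
    have := hdeg c v
    rw [Fintype.card_fin]
    have e : deg (Gs c) v = (nb Gs c v).card := by
      rw [deg, ← Set.ncard_coe_finset]
      congr 1
      ext u; simp [mem_nb]
    omega
  obtain ⟨a, b, h⟩ := exists_RP (Gs := Gs) (by rw [Fintype.card_fin]; omega) hd
  obtain ⟨p, cs, h1, h2, h3, h4, h5⟩ := h.toWalk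
  refine ⟨a, b, p, ?_, ?_⟩
  · intro v
    exact List.count_eq_one_of_mem h1 (by rw [← List.mem_toFinset, h2]; simp)
  · have hlen := h5.length_eq
    refine ⟨(finCongr hlen).trans (List.Nodup.getEquivOfForallMemList cs h3
      (fun c => by rw [← List.mem_toFinset, h4]; simp)), fun i => ?_⟩
    have := h5.get i.2 (hlen ▸ i.2)
    simpa using this
end

section
/- For sufficiently large odd n, let G be an n-vertex graph with δ(G) ≥ (n-1)/2 that contains no Hamilton cycle. Then either G is isomorphic to K_1 ∨ (K_{(n-1)/2} ∪ K_{(n-1)/2}), or G is a spanning subgraph of ((n+1)/2)·K_1 ∨ K_{(n-1)/2} (i.e., the join of an independent set of size (n+1)/2 with a clique of size (n-1)/2). -/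
open SimpleGraph

namespace S11

set_option linter.unusedSectionVars false

variable {V : Type} [Fintype V] [DecidableEq V]

/-- `f 0, …, f (k-1)` is a path. -/
def PathF (G : SimpleGraph V) (f : ℕ → V) (k : ℕ) : Prop :=
  (∀ i j, i < k → j < k → f i = f j → i = j) ∧ ∀ i, i + 1 < k → G.Adj (f i) (f (i + 1))

/-- `f 0, …, f (k-1)` is a cycle. -/
def CycF (G : SimpleGraph V) (f : ℕ → V) (k : ℕ) : Prop :=
  PathF G f k ∧ G.Adj (f (k - 1)) (f 0)

lemma walk_of_path (G : SimpleGraph V) (f : ℕ → V) (k : ℕ)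
    (h : ∀ i, i + 1 < k + 1 → G.Adj (f i) (f (i + 1))) :
    ∃ p : G.Walk (f 0) (f k), p.support = (List.range (k + 1)).map f ∧
      ∀ e ∈ p.edges, ∃ i, i < k ∧ e = s(f i, f (i + 1)) := by
  induction k with
  | zero => exact ⟨Walk.nil, by simp, by simp⟩
  | succ k ih =>
    obtain ⟨p, hp, he⟩ := ih (fun i hi => h i (by omega))
    refine ⟨p.concat (h k (by omega)), ?_, ?_⟩
    · rw [Walk.support_concat, hp, List.range_succ (n := k + 1)]
      simp
    · intro e hee
      rw [Walk.edges_concat] at hee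
      simp only [List.concat_eq_append, List.mem_append, List.mem_singleton] at hee
      rcases hee with hee | hee
      · obtain ⟨i, hi, h'⟩ := he e hee
        exact ⟨i, by omega, h'⟩
      · exact ⟨k, by omega, hee⟩

lemma ham_of_cyc (G : SimpleGraph V) (f : ℕ → V) (n : ℕ) (hn : 3 ≤ n)
    (hc : Fintype.card V = n) (h : CycF G f n) :
    ∃ (v : V) (p : G.Walk v v), p.IsHamiltonianCycle := by
  obtain ⟨k, rfl⟩ : ∃ k, n = k + 1 := ⟨n - 1, by omega⟩
  obtain ⟨⟨hinj, hadj⟩, hcl⟩ := h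
  obtain ⟨p, hp, he⟩ := walk_of_path G f k hadj
  have hnd : p.support.Nodup := by
    rw [hp]
    refine List.Nodup.map_on ?_ List.nodup_range
    intro x hx y hy hxy
    exact hinj x y (List.mem_range.1 hx) (List.mem_range.1 hy) hxy
  have hpath : p.IsPath := (Walk.isPath_def p).2 hnd
  have hham : p.IsHamiltonian := by
    rw [hpath.isHamiltonian_iff]
    intro w
    have h1 : p.support.toFinset.card = Fintype.card V := by
      rw [List.toFinset_card_of_nodup hnd, hp, hc]; simp
    have h2 := (Finset.card_eq_iff_eq_univ _).1 h1
    have : w ∈ p.support.toFinset := by rw [h2]; simp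
    simpa using this
  have hcl' : G.Adj (f k) (f 0) := by simpa using hcl
  refine ⟨f k, Walk.cons hcl' p, ?_⟩
  rw [Walk.isHamiltonianCycle_iff_isCycle_and_support_count_tail_eq_one]
  refine ⟨?_, ?_⟩
  · rw [Walk.cons_isCycle_iff]
    refine ⟨hpath, fun hmem => ?_⟩
    obtain ⟨i, hi, h'⟩ := he _ hmem
    rw [Sym2.eq_iff] at h'
    rcases h' with ⟨h1, h2⟩ | ⟨h1, h2⟩
    · have := hinj k i (by omega) (by omega) h1
      omega
    · have := hinj k (i+1) (by omega) (by omega) h1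
      have := hinj 0 i (by omega) (by omega) h2
      omega
  · intro a
    simpa using hham a

open Classical in
lemma deg_le (G : SimpleGraph V) (v : V) (h : ℕ → V) (K : ℕ)
    (hs : ∀ u, G.Adj v u → ∃ i, i < K ∧ u = h i) :
    deg G v ≤ ((Finset.range K).filter (fun i => G.Adj v (h i))).card := by
  unfold deg
  calc (G.neighborSet v).ncard
      ≤ ((((Finset.range K).filter (fun i => G.Adj v (h i))).image h : Finset V) : Set V).ncard := by
        apply Set.ncard_le_ncard
        · intro u hu
          obtain ⟨i, hi, rfl⟩ := hs u hu
          simp only [Finset.coe_image, Set.mem_image, Finset.coe_filter, Finset.mem_range]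
          exact ⟨i, ⟨hi, hu⟩, rfl⟩
        · exact Finset.finite_toSet _
    _ ≤ _ := by
        rw [Set.ncard_coe_finset]
        exact Finset.card_image_le

open Classical in
/-- The basic counting lemma. -/
lemma counting (P Q : ℕ → Prop) (K m : ℕ)
    (hP : m ≤ ((Finset.range K).filter P).card) (hQ : m ≤ ((Finset.range K).filter Q).card)
    (hd : ∀ i, i < K → P i → Q i → False) (hK : K ≤ 2 * m) :
    K = 2 * m ∧ ((Finset.range K).filter P).card = m ∧ ∀ i, i < K → P i ∨ Q i := by
  have hdis : Disjoint ((Finset.range K).filter P) ((Finset.range K).filter Q) := by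
    rw [Finset.disjoint_left]
    intro i h1 h2
    simp only [Finset.mem_filter, Finset.mem_range] at h1 h2
    exact hd i h1.1 h1.2 h2.2
  have hsub : (Finset.range K).filter P ∪ (Finset.range K).filter Q ⊆ Finset.range K := by
    intro i; simp; tauto
  have hcard := Finset.card_union_of_disjoint hdis
  have hle := Finset.card_le_card hsub
  rw [Finset.card_range] at hle
  refine ⟨by omega, by omega, fun i hi => ?_⟩
  have := Finset.eq_of_subset_of_card_le hsub (by rw [Finset.card_range]; omega)
  have hi' : i ∈ Finset.range K := by simpa using hi
  rw [← this] at hi'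
  simp only [Finset.mem_union, Finset.mem_filter] at hi'
  tauto

lemma path_rev {G : SimpleGraph V} {f : ℕ → V} {k : ℕ} (h : PathF G f k) :
    PathF G (fun i => f (k - 1 - i)) k := by
  refine ⟨fun i j hi hj e => ?_, fun i hi => ?_⟩
  · have := h.1 _ _ (by omega) (by omega) e
    omega
  · have := h.2 (k - 1 - (i + 1)) (by omega)
    rw [show k - 1 - (i + 1) + 1 = k - 1 - i by omega] at this
    exact this.symm

lemma path_prepend {G : SimpleGraph V} {f : ℕ → V} {k : ℕ} (h : PathF G f k) (w : V)
    (hw : ∀ i, i < k → f i ≠ w) (ha : G.Adj w (f 0)) :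
    PathF G (fun i => if i = 0 then w else f (i - 1)) (k + 1) := by
  refine ⟨fun i j hi hj e => ?_, fun i hi => ?_⟩
  · have h1 := h.1 (i - 1) (j - 1)
    have h2 := hw (i - 1)
    have h3 := hw (j - 1)
    try simp only at e
    split_ifs at e with h4 h5 h5
    · omega
    · exact absurd e.symm (h3 (by omega))
    · exact absurd e (h2 (by omega))
    · have := h1 (by omega) (by omega) e
      omega
  · simp only [Nat.add_eq_zero_iff, one_ne_zero, and_false, if_false, Nat.add_sub_cancel]
    split_ifs with h1
    · subst h1; exact ha
    · have := h.2 (i - 1) (by omega)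
      rwa [show i - 1 + 1 = i by omega] at this

lemma cyc_rot {G : SimpleGraph V} {f : ℕ → V} {k : ℕ} (h : CycF G f k) (a : ℕ) (ha : a < k) :
    PathF G (fun i => if a + i < k then f (a + i) else f (a + i - k)) k := by
  obtain ⟨h, hc⟩ := h
  refine ⟨fun i j hi hj e => ?_, fun i hi => ?_⟩
  · simp only at e
    split_ifs at e
    all_goals
      have := h.1 _ _ (by omega) (by omega) e
      omega
  · try simp only
    split_ifs
    · exact h.2 (a + i) (by omega)
    · rw [show a + i = k - 1 by omega, show a + (i + 1) - k = 0 by omega]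
      exact hc
    · omega
    · have := h.2 (a + i - k) (by omega)
      rwa [show a + i - k + 1 = a + (i + 1) - k by omega] at this

lemma cyc_insert {G : SimpleGraph V} {f : ℕ → V} {k : ℕ} (h : CycF G f k) (w : V)
    (hw : ∀ i, i < k → f i ≠ w) (i : ℕ) (hi : i < k) (h1 : G.Adj w (f i))
    (h2 : G.Adj w (f (if i + 1 < k then i + 1 else 0))) :
    CycF G (fun j => if j ≤ i then f j else if j = i + 1 then w else f (j - 1)) (k + 1) := by
  obtain ⟨h, hc⟩ := h
  refine ⟨⟨fun x y hx hy e => ?_, fun x hx => ?_⟩, ?_⟩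
  · simp only at e
    split_ifs at e
    all_goals first
      | omega
      | exact absurd e (hw _ (by omega))
      | exact absurd e.symm (hw _ (by omega))
      | (have := h.1 _ _ (by omega) (by omega) e
         omega)
  · try simp only
    split_ifs
    all_goals first
      | omega
      | exact h.2 x (by omega)
      | (rw [show x = i by omega]; exact h1.symm)
      | (rw [if_pos (by omega)] at h2; rwa [show x + 1 - 1 = i + 1 by omega])
      | (have := h.2 (x - 1) (by omega)
         rwa [show x - 1 + 1 = x + 1 - 1 by omega] at this)
  · simp only [Nat.add_sub_cancel]
    rw [if_neg (by omega : ¬ k ≤ i), if_pos (Nat.zero_le i)]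
    split_ifs with h3
    · rwa [if_neg (by omega)] at h2
    · exact hc

/-- Crossing. -/
lemma cyc_cross {G : SimpleGraph V} {f : ℕ → V} {k : ℕ} (h : PathF G f k) (i : ℕ)
    (hi : i + 1 < k) (h1 : G.Adj (f 0) (f (i + 1))) (h2 : G.Adj (f (k - 1)) (f i)) :
    CycF G (fun j => if j ≤ i then f j else f (k + i - j)) k := by
  refine ⟨⟨fun x y hx hy e => ?_, fun x hx => ?_⟩, ?_⟩
  · simp only at e
    split_ifs at e
    all_goals
      have := h.1 _ _ (by omega) (by omega) e
      omega
  · try simp only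
    split_ifs
    · exact h.2 x (by omega)
    · rw [show x = i by omega, show k + i - (i + 1) = k - 1 by omega]
      exact h2.symm
    · omega
    · have := h.2 (k + i - (x + 1)) (by omega)
      rw [show k + i - (x + 1) + 1 = k + i - x by omega] at this
      exact this.symm
  · try simp only
    rw [if_neg (by omega), if_pos (by omega), show k + i - (k - 1) = i + 1 by omega]
    exact h1.symm

/-- Crossing, omitting `f i`. -/
lemma cyc_cross' {G : SimpleGraph V} {f : ℕ → V} {k : ℕ} (h : PathF G f (k + 1)) (i : ℕ)
    (hi0 : 1 ≤ i) (hi : i < k) (h1 : G.Adj (f 0) (f (i + 1))) (h2 : G.Adj (f k) (f (i - 1))) :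
    CycF G (fun j => if j < i then f j else f (k + i - j)) k := by
  refine ⟨⟨fun x y hx hy e => ?_, fun x hx => ?_⟩, ?_⟩
  · simp only at e
    split_ifs at e
    all_goals
      have := h.1 _ _ (by omega) (by omega) e
      omega
  · try simp only
    split_ifs
    · exact h.2 x (by omega)
    · rw [show x = i - 1 by omega, show k + i - (i - 1 + 1) = k by omega]
      exact h2.symm
    · omega
    · have := h.2 (k + i - (x + 1)) (by omega)
      rw [show k + i - (x + 1) + 1 = k + i - x by omega] at this
      exact this.symm
  · try simp only
    rw [if_neg (by omega), if_pos (by omega), show k + i - (k - 1) = i + 1 by omega]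
    exact h1.symm

lemma card_image {f : ℕ → V} {k : ℕ} (h : ∀ i j, i < k → j < k → f i = f j → i = j) :
    ((Finset.range k).image f).card = k := by
  rw [Finset.card_image_of_injOn, Finset.card_range]
  intro x hx y hy e
  exact h x y (by simpa using hx) (by simpa using hy) e

lemma path_step {G : SimpleGraph V} {m : ℕ} (hc : Fintype.card V = 2 * m + 1)
    (hdeg : ∀ v, m ≤ deg G v) {f : ℕ → V} {k : ℕ} (hk : 1 ≤ k) (hkn : k < 2 * m + 1)
    (h : PathF G f k) : ∃ g, PathF G g (k + 1) := by
  classical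
  by_cases h0 : ∃ w, (∀ i, i < k → f i ≠ w) ∧ G.Adj w (f 0)
  · obtain ⟨w, hw, ha⟩ := h0
    exact ⟨_, path_prepend h w hw ha⟩
  by_cases h1 : ∃ w, (∀ i, i < k → f i ≠ w) ∧ G.Adj w (f (k - 1))
  · obtain ⟨w, hw, ha⟩ := h1
    exact ⟨_, path_prepend (path_rev h) w (fun i hi => hw _ (by omega)) (by simpa using ha)⟩
  push Not at h0 h1
  have hn0 : ∀ u, G.Adj (f 0) u → ∃ i, i < k - 1 ∧ u = f (i + 1) := by
    intro u hu
    by_contra hcon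
    push Not at hcon
    refine h0 u (fun i hi e => ?_) hu.symm
    rcases Nat.eq_zero_or_pos i with rfl | hip
    · rw [e] at hu; exact hu.ne rfl
    · exact hcon (i - 1) (by omega) (by rw [show i - 1 + 1 = i by omega, e])
  have hn1 : ∀ u, G.Adj (f (k - 1)) u → ∃ i, i < k - 1 ∧ u = f i := by
    intro u hu
    by_contra hcon
    push Not at hcon
    refine h1 u (fun i hi e => ?_) hu.symm
    rcases Nat.lt_or_ge i (k - 1) with hip | hip
    · exact hcon i hip e.symm
    · rw [show k - 1 = i by omega, e] at hu; exact hu.ne rfl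
  have c0 := (hdeg _).trans (deg_le G (f 0) (fun i => f (i + 1)) (k - 1) hn0)
  have c1 := (hdeg _).trans (deg_le G (f (k - 1)) f (k - 1) hn1)
  have hkm : m ≤ k - 1 := by
    have := Finset.card_filter_le (Finset.range (k - 1)) (fun i => G.Adj (f 0) (f (i + 1)))
    rw [Finset.card_range] at this
    omega
  have hex : ∃ i, i < k - 1 ∧ G.Adj (f 0) (f (i + 1)) ∧ G.Adj (f (k - 1)) (f i) := by
    by_contra hcon
    push Not at hcon
    have := (counting _ _ (k - 1) m c0 c1 (fun i hi a b => hcon i hi a b) (by omega)).1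
    omega
  obtain ⟨i, hi, ha, hb⟩ := hex
  have hcyc := cyc_cross h i (by omega) ha hb
  set g : ℕ → V := fun j => if j ≤ i then f j else f (k + i - j) with hg
  have himg := card_image hcyc.1.1
  -- some edge leaves the cycle
  have hleave : ∃ w, (∀ i, i < k → g i ≠ w) ∧ ∃ j, j < k ∧ G.Adj w (g j) := by
    by_contra hcon
    push Not at hcon
    obtain ⟨w, hw⟩ : ∃ w, w ∉ (Finset.range k).image g := by
      by_contra hall
      push Not at hall
      have := Finset.card_le_card (fun w _ => hall w : (Finset.univ : Finset V) ⊆ _)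
      rw [himg, Finset.card_univ] at this
      omega
    have hw' : ∀ i, i < k → g i ≠ w := by
      intro i hi e
      exact hw (Finset.mem_image.2 ⟨i, by simpa using hi, e⟩)
    have hno := hcon w hw'
    have hsub : G.neighborSet w ⊆ (((insert w ((Finset.range k).image g))ᶜ : Finset V) : Set V) := by
      intro u hu
      simp only [Finset.coe_compl, Set.mem_compl_iff, Finset.mem_coe, Finset.mem_insert,
        Finset.mem_image, Finset.mem_range, not_or, not_exists, not_and]
      refine ⟨fun e => ?_, fun j hj e => ?_⟩
      · rw [e] at hu; exact (G.ne_of_adj hu) rfl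
      · exact hno j hj (e ▸ hu)
    have hle := Set.ncard_le_ncard hsub (Finset.finite_toSet _)
    rw [Set.ncard_coe_finset, Finset.card_compl, Finset.card_insert_of_notMem hw, himg] at hle
    have := hdeg w
    unfold deg at this
    omega
  obtain ⟨w, hw, j, hj, hwj⟩ := hleave
  refine ⟨_, path_prepend (cyc_rot hcyc j hj) w (fun i hi => ?_) ?_⟩
  · try simp only
    split_ifs
    · exact hw _ (by omega)
    · exact hw _ (by omega)
  · simpa [hj] using hwj

lemma exists_ham_path {G : SimpleGraph V} {m : ℕ} (hc : Fintype.card V = 2 * m + 1)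
    (hdeg : ∀ v, m ≤ deg G v) : ∀ k, k < 2 * m + 1 → ∃ f, PathF G f (k + 1) := by
  intro k
  induction k with
  | zero =>
    intro _
    have : Nonempty V := Fintype.card_pos_iff.1 (by omega)
    exact ⟨fun _ => Classical.arbitrary V, fun i j hi hj _ => by omega, fun i hi => by omega⟩
  | succ k ih =>
    intro hk
    obtain ⟨f, hf⟩ := ih (by omega)
    exact path_step hc hdeg (by omega) hk hf

open Classical in
/-- Neighbours of the vertex missed by a cycle of length `n - 1`. -/
lemma alternate {G : SimpleGraph V} {m : ℕ} (hm : 2 ≤ m) (hc : Fintype.card V = 2 * m + 1)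
    (hdeg : ∀ v, m ≤ deg G v) (hno : ∀ f, ¬ CycF G f (2 * m + 1))
    {f : ℕ → V} (h : CycF G f (2 * m)) (w : V) (hw : ∀ i, i < 2 * m → f i ≠ w) :
    ((Finset.range (2 * m)).filter (fun i => G.Adj w (f i))).card = m ∧
    ∀ i, i < 2 * m → (G.Adj w (f i) ↔ ¬ G.Adj w (f (if i + 1 < 2 * m then i + 1 else 0))) := by
  have hwn : w ∉ (Finset.range (2 * m)).image f := by
    intro hmem
    obtain ⟨i, hi, e⟩ := Finset.mem_image.1 hmem
    exact hw i (by simpa using hi) e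
  have huniv : insert w ((Finset.range (2 * m)).image f) = Finset.univ := by
    rw [← Finset.card_eq_iff_eq_univ, Finset.card_insert_of_notMem hwn, card_image h.1.1, hc]
  have hsurj : ∀ u, G.Adj w u → ∃ i, i < 2 * m ∧ u = f i := by
    intro u hu
    have : u ∈ insert w ((Finset.range (2 * m)).image f) := by rw [huniv]; simp
    rw [Finset.mem_insert, Finset.mem_image] at this
    rcases this with rfl | ⟨i, hi, e⟩
    · exact absurd rfl hu.ne
    · exact ⟨i, by simpa using hi, e.symm⟩
  have hsurj' : ∀ u, G.Adj w u → ∃ i, i < 2 * m ∧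
      u = f (if i + 1 < 2 * m then i + 1 else 0) := by
    intro u hu
    obtain ⟨i, hi, e⟩ := hsurj u hu
    rcases Nat.eq_zero_or_pos i with rfl | hip
    · exact ⟨2 * m - 1, by omega, by rw [if_neg (by omega), e]⟩
    · exact ⟨i - 1, by omega, by rw [if_pos (by omega), e, show i - 1 + 1 = i by omega]⟩
  have c0 := (hdeg _).trans (deg_le G w f (2 * m) hsurj)
  have c1 := (hdeg _).trans
    (deg_le G w (fun i => f (if i + 1 < 2 * m then i + 1 else 0)) (2 * m) hsurj')
  have hd : ∀ i, i < 2 * m → G.Adj w (f i) →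
      G.Adj w (f (if i + 1 < 2 * m then i + 1 else 0)) → False :=
    fun i hi a b => hno _ (cyc_insert h w hw i hi a b)
  obtain ⟨-, e1, e2⟩ := counting _ _ (2 * m) m c0 c1 hd le_rfl
  exact ⟨e1, fun i hi => ⟨hd i hi, fun hn => (e2 i hi).resolve_right hn⟩⟩

lemma cyc_swap {G : SimpleGraph V} {m : ℕ} (hm : 2 ≤ m)
    {f : ℕ → V} (h : CycF G f (2 * m)) (w : V) (hw : ∀ i, i < 2 * m → f i ≠ w)
    (i : ℕ) (hi : i < 2 * m)
    (h1 : G.Adj w (f (if i + 1 < 2 * m then i + 1 else 0)))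
    (h2 : G.Adj w (f (if i = 0 then 2 * m - 1 else i - 1))) :
    CycF G (fun j => if j = i then w else f j) (2 * m) := by
  obtain ⟨h, hcl⟩ := h
  refine ⟨⟨fun x y hx hy e => ?_, fun x hx => ?_⟩, ?_⟩
  · simp only at e
    split_ifs at e
    · omega
    · exact absurd e.symm (hw _ hy)
    · exact absurd e (hw _ hx)
    · exact h.1 x y hx hy e
  · try simp only
    split_ifs
    · omega
    · rw [if_pos (by omega)] at h1
      rwa [show x = i by omega]
    · rw [if_neg (by omega)] at h2
      rw [show x = i - 1 by omega]
      exact h2.symm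
    · exact h.2 x hx
  · try simp only
    split_ifs
    · omega
    · rwa [if_neg (by omega)] at h1
    · rw [if_pos (by omega)] at h2
      exact h2.symm
    · exact hcl

lemma indep_of_cyc {G : SimpleGraph V} {m : ℕ} (hm : 2 ≤ m) (hc : Fintype.card V = 2 * m + 1)
    (hdeg : ∀ v, m ≤ deg G v) (hno : ∀ f, ¬ CycF G f (2 * m + 1))
    {f : ℕ → V} (h : CycF G f (2 * m)) (w : V) (hw : ∀ i, i < 2 * m → f i ≠ w) :
    ∃ A : Set V, A.ncard = m + 1 ∧ ∀ x ∈ A, ∀ y ∈ A, ¬ G.Adj x y := by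
  classical
  obtain ⟨hcard, halt⟩ := alternate hm hc hdeg hno h w hw
  set N := (Finset.range (2 * m)).filter (fun i => ¬ G.Adj w (f i)) with hN
  have hNc : N.card = m := by
    have := Finset.card_filter_add_card_filter_not (s := Finset.range (2 * m))
      (fun i => G.Adj w (f i))
    rw [Finset.card_range] at this
    have e2 : ((Finset.range (2 * m)).filter (fun i => G.Adj w (f i))).card + N.card = 2 * m := by
      convert this
    rw [hcard] at e2
    omega
  have key : ∀ i j, i < 2 * m → j < 2 * m → ¬ G.Adj w (f i) → ¬ G.Adj w (f j) →
      ¬ G.Adj (f i) (f j) := by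
    intro i j hi hj hni hnj hadj
    have hij : i ≠ j := by rintro rfl; exact hadj.ne rfl
    have hsucc : G.Adj w (f (if i + 1 < 2 * m then i + 1 else 0)) := by
      have := halt i hi
      tauto
    have hpred : G.Adj w (f (if i = 0 then 2 * m - 1 else i - 1)) := by
      split_ifs with hi0
      · have := halt (2 * m - 1) (by omega)
        rw [if_neg (by omega)] at this
        subst hi0
        tauto
      · have := halt (i - 1) (by omega)
        rw [if_pos (by omega), show i - 1 + 1 = i by omega] at this
        tauto
    have hcyc := cyc_swap hm h w hw i hi hsucc hpred
    set g : ℕ → V := fun j => if j = i then w else f j with hg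
    have hgw : ∀ j, j < 2 * m → g j ≠ f i := by
      intro j hj e
      simp only [hg] at e
      split_ifs at e with hji
      · exact hw i hi e.symm
      · exact hji (h.1.1 _ _ hj hi e)
    obtain ⟨-, halt'⟩ := alternate hm hc hdeg hno hcyc (f i) hgw
    have hpar : ∀ k, k < 2 * m → ((G.Adj w (f k) ↔ G.Adj (f i) (g k)) ↔
        (G.Adj w (f 0) ↔ G.Adj (f i) (g 0))) := by
      intro k
      induction k with
      | zero => intro _; exact Iff.rfl
      | succ k ih =>
        intro hk
        have a := ih (by omega)
        have b := halt k (by omega)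
        have c := halt' k (by omega)
        rw [if_pos hk] at b c
        rw [← a, b, c, not_iff_not]
    -- at the successor of i both hold
    have hs2 : G.Adj (f i) (g (if i + 1 < 2 * m then i + 1 else 0)) := by
      simp only [hg]
      split_ifs
      · omega
      · exact h.1.2 i (by omega)
      · omega
      · have := h.2
        rwa [show 2 * m - 1 = i by omega] at this
    have hz := hpar (if i + 1 < 2 * m then i + 1 else 0) (by split_ifs <;> omega)
    have hzj := hpar j hj
    have hgj : g j = f j := by simp only [hg]; rw [if_neg (Ne.symm hij)]
    rw [hgj] at hzj
    exact hnj ((hzj.2 (hz.1 ⟨fun _ => hs2, fun _ => hsucc⟩)).2 hadj)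
  refine ⟨((insert w (N.image f) : Finset V) : Set V), ?_, ?_⟩
  · rw [Set.ncard_coe_finset, Finset.card_insert_of_notMem, Finset.card_image_of_injOn, hNc]
    · intro x hx y hy e
      simp only [hN, Finset.coe_filter, Finset.mem_range, Set.mem_setOf_eq] at hx hy
      exact h.1.1 x y hx.1 hy.1 e
    · intro hmem
      obtain ⟨i, hi, e⟩ := Finset.mem_image.1 hmem
      rw [hN, Finset.mem_filter, Finset.mem_range] at hi
      exact hw i hi.1 e
  · have hmemN : ∀ x, x ∈ ((insert w (N.image f) : Finset V) : Set V) →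
        x = w ∨ ∃ i, i < 2 * m ∧ ¬ G.Adj w (f i) ∧ x = f i := by
      intro x hx
      rw [Finset.mem_coe, Finset.mem_insert, Finset.mem_image] at hx
      rcases hx with hx | ⟨i, hi, e⟩
      · exact Or.inl hx
      · rw [hN, Finset.mem_filter, Finset.mem_range] at hi
        exact Or.inr ⟨i, hi.1, hi.2, e.symm⟩
    intro x hx y hy
    rcases hmemN x hx with rfl | ⟨i, hi, hi', rfl⟩ <;>
    rcases hmemN y hy with rfl | ⟨j, hj, hj', rfl⟩
    · exact G.loopless.irrefl _
    · exact hj'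
    · exact fun e => hi' e.symm
    · exact fun hadj => key i j hi hj hi' hj' hadj

/-- Structure of a Hamilton path when there is no independent set. -/
lemma path_struct {G : SimpleGraph V} {m : ℕ} (hm : 2 ≤ m) (hc : Fintype.card V = 2 * m + 1)
    (hdeg : ∀ v, m ≤ deg G v) (hno : ∀ f, ¬ CycF G f (2 * m + 1))
    (hind : ¬ ∃ A : Set V, A.ncard = m + 1 ∧ ∀ x ∈ A, ∀ y ∈ A, ¬ G.Adj x y)
    {f : ℕ → V} (h : PathF G f (2 * m + 1)) :
    ∀ i, i < 2 * m → (G.Adj (f 0) (f (i + 1)) ↔ i < m) := by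
  classical
  have huniv : (Finset.range (2 * m + 1)).image f = Finset.univ := by
    rw [← Finset.card_eq_iff_eq_univ, card_image h.1, hc]
  have hsurj : ∀ u, ∃ i, i < 2 * m + 1 ∧ f i = u := by
    intro u
    have : u ∈ (Finset.range (2 * m + 1)).image f := by rw [huniv]; simp
    rw [Finset.mem_image] at this
    obtain ⟨i, hi, e⟩ := this
    exact ⟨i, by simpa using hi, e⟩
  have hn0 : ∀ u, G.Adj (f 0) u → ∃ i, i < 2 * m ∧ u = f (i + 1) := by
    intro u hu
    obtain ⟨i, hi, rfl⟩ := hsurj u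
    rcases Nat.eq_zero_or_pos i with rfl | hip
    · exact absurd rfl hu.ne
    · exact ⟨i - 1, by omega, by rw [show i - 1 + 1 = i by omega]⟩
  have hn1 : ∀ u, G.Adj (f (2 * m)) u → ∃ i, i < 2 * m ∧ u = f i := by
    intro u hu
    obtain ⟨i, hi, rfl⟩ := hsurj u
    refine ⟨i, ?_, rfl⟩
    rcases Nat.lt_or_ge i (2 * m) with hip | hip
    · exact hip
    · rw [show i = 2 * m by omega] at hu
      exact absurd rfl hu.ne
  have c0 := (hdeg _).trans (deg_le G (f 0) (fun i => f (i + 1)) (2 * m) hn0)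
  have c1 := (hdeg _).trans (deg_le G (f (2 * m)) f (2 * m) hn1)
  obtain ⟨-, hS, hor⟩ := counting _ _ (2 * m) m c0 c1
    (fun i hi a b => hno _ (cyc_cross h i (by omega) a (by simpa using b))) le_rfl
  have hdown1 : ∀ i, i + 1 < 2 * m → G.Adj (f 0) (f (i + 1 + 1)) → G.Adj (f 0) (f (i + 1)) := by
    intro i hi ha
    refine (hor i (by omega)).resolve_right (fun hb => hind ?_)
    have hcyc := cyc_cross' h (i + 1) (by omega) hi ha (by simpa using hb)
    refine indep_of_cyc hm hc hdeg hno hcyc (f (i + 1)) (fun j hj e => ?_)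
    try simp only at e
    split_ifs at e
    all_goals
      have := h.1 _ _ (by omega) (by omega) e
      omega
  have hdown : ∀ i, i < 2 * m → G.Adj (f 0) (f (i + 1)) → ∀ j, j ≤ i → G.Adj (f 0) (f (j + 1)) := by
    intro i
    induction i with
    | zero => intro _ h0 j hj; rwa [show j = 0 by omega]
    | succ i ih =>
      intro hi ha j hj
      rcases Nat.lt_or_ge i j with hij | hij
      · rwa [show j = i + 1 by omega]
      · exact ih (by omega) (hdown1 i hi ha) j hij
  intro i hi
  constructor
  · intro ha
    have hsub : Finset.range (i + 1) ⊆
        (Finset.range (2 * m)).filter (fun i => G.Adj (f 0) (f (i + 1))) := by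
      intro j hj
      rw [Finset.mem_range] at hj
      rw [Finset.mem_filter, Finset.mem_range]
      exact ⟨by omega, hdown i hi ha j (by omega)⟩
    have := Finset.card_le_card hsub
    rw [Finset.card_range, hS] at this
    omega
  · intro him
    by_contra hna
    have hsub : (Finset.range (2 * m)).filter (fun i => G.Adj (f 0) (f (i + 1))) ⊆
        Finset.range i := by
      intro j hj
      rw [Finset.mem_filter, Finset.mem_range] at hj
      rw [Finset.mem_range]
      by_contra hij
      exact hna (hdown j hj.1 hj.2 i (by omega))
    have := Finset.card_le_card hsub
    rw [Finset.card_range, hS] at this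
    omega

lemma path_struct' {G : SimpleGraph V} {m : ℕ} (hm : 2 ≤ m) (hc : Fintype.card V = 2 * m + 1)
    (hdeg : ∀ v, m ≤ deg G v) (hno : ∀ f, ¬ CycF G f (2 * m + 1))
    (hind : ¬ ∃ A : Set V, A.ncard = m + 1 ∧ ∀ x ∈ A, ∀ y ∈ A, ¬ G.Adj x y)
    {f : ℕ → V} (h : PathF G f (2 * m + 1)) (a : ℕ) (ha : a < m) (j : ℕ) (hj : j ≤ 2 * m)
    (haj : j ≠ a) : G.Adj (f a) (f j) ↔ j ≤ m := by
  have h0 := path_struct hm hc hdeg hno hind h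
  have hg : PathF G (fun i => if i ≤ a then f (a - i) else f i) (2 * m + 1) := by
    refine ⟨fun x y hx hy e => ?_, fun x hx => ?_⟩
    · simp only at e
      split_ifs at e
      all_goals
        have := h.1 _ _ (by omega) (by omega) e
        omega
    · try simp only
      split_ifs
      · have := h.2 (a - (x + 1)) (by omega)
        rw [show a - (x + 1) + 1 = a - x by omega] at this
        exact this.symm
      · rw [show a - x = 0 by omega]
        exact (h0 x (by omega)).2 (by omega)
      · omega
      · exact h.2 x hx
  have h1 := path_struct hm hc hdeg hno hind hg
  rcases Nat.lt_or_ge j a with hja | hja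
  · have := h1 (a - j - 1) (by omega)
    try simp only at this
    rw [if_pos (by omega), if_pos (by omega), show a - (a - j - 1 + 1) = j by omega,
      Nat.sub_zero] at this
    rw [this]; omega
  · have := h1 (j - 1) (by omega)
    try simp only at this
    rw [if_pos (by omega), if_neg (by omega), show j - 1 + 1 = j by omega,
      Nat.sub_zero] at this
    rw [this]; omega

end S11

/-- Structure of non-Hamiltonian graphs with `δ(G) ≥ (n-1)/2`, `n` odd and large:
either `K₁ ∨ (K_{(n-1)/2} ∪ K_{(n-1)/2})` or a spanning subgraph of
`((n+1)/2)K₁ ∨ K_{(n-1)/2}`. -/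
theorem stmt_11 :
    ∃ n₀ : ℕ, ∀ n : ℕ, n₀ ≤ n → Odd n →
      ∀ (V : Type) [Fintype V] [DecidableEq V] (G : SimpleGraph V),
        Fintype.card V = n →
        (∀ v, n - 1 ≤ 2 * deg G v) →
        (¬ ∃ (v : V) (p : G.Walk v v), p.IsHamiltonianCycle) →
        ((∃ (u : V) (A B : Set V), Disjoint A B ∧ A ∪ B = Set.univ \ {u} ∧
            A.ncard = (n - 1) / 2 ∧ B.ncard = (n - 1) / 2 ∧
            ∀ x y, G.Adj x y ↔ x ≠ y ∧
              (x = u ∨ y = u ∨ (x ∈ A ∧ y ∈ A) ∨ (x ∈ B ∧ y ∈ B)))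
          ∨ (∃ A : Set V, A.ncard = (n + 1) / 2 ∧ ∀ x ∈ A, ∀ y ∈ A, ¬ G.Adj x y)) := by
  refine ⟨5, ?_⟩
  intro n hn hodd V _ _ G hcard hdeg hham
  obtain ⟨m, rfl⟩ := hodd
  have hm : 2 ≤ m := by omega
  have hdeg' : ∀ v, m ≤ deg G v := fun v => by have := hdeg v; omega
  have hno : ∀ f, ¬ S11.CycF G f (2 * m + 1) := fun f hf =>
    hham (S11.ham_of_cyc G f _ (by omega) hcard hf)
  rw [show (2 * m + 1 + 1) / 2 = m + 1 by omega, show (2 * m + 1 - 1) / 2 = m by omega]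
  by_cases hind : ∃ A : Set V, A.ncard = m + 1 ∧ ∀ x ∈ A, ∀ y ∈ A, ¬ G.Adj x y
  · exact Or.inr hind
  left
  obtain ⟨f, hf⟩ := S11.exists_ham_path hcard hdeg' (2 * m) (by omega)
  have hlow := S11.path_struct' hm hcard hdeg' hno hind hf
  have hhigh : ∀ b, m < b → b ≤ 2 * m → ∀ j, j ≤ 2 * m → j ≠ b →
      (G.Adj (f b) (f j) ↔ m ≤ j) := by
    intro b hb hb' j hj hjb
    have := S11.path_struct' hm hcard hdeg' hno hind (S11.path_rev hf) (2 * m - b) (by omega)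
      (2 * m - j) (by omega) (by omega)
    try simp only at this
    rw [show 2 * m + 1 - 1 - (2 * m - b) = b by omega,
      show 2 * m + 1 - 1 - (2 * m - j) = j by omega] at this
    rw [this]; omega
  have hadj : ∀ i j, i ≤ 2 * m → j ≤ 2 * m → (G.Adj (f i) (f j) ↔
      i ≠ j ∧ (i = m ∨ j = m ∨ (i < m ∧ j < m) ∨ (m < i ∧ m < j))) := by
    intro i j hi hj
    by_cases hij : i = j
    · subst hij
      simp
    rcases Nat.lt_trichotomy i m with h1 | h1 | h1
    · rw [hlow i h1 j hj (Ne.symm hij)]; omega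
    · rcases Nat.lt_trichotomy j m with h2 | h2 | h2
      · rw [G.adj_comm, hlow j h2 i hi hij]; omega
      · omega
      · rw [G.adj_comm, hhigh j h2 hj i hi hij]; omega
    · rw [hhigh i h1 hi j hj (Ne.symm hij)]; omega
  have hinj : ∀ i j, i ≤ 2 * m → j ≤ 2 * m → (f i = f j ↔ i = j) := fun i j hi hj =>
    ⟨fun e => hf.1 i j (by omega) (by omega) e, fun e => by rw [e]⟩
  have huniv : (Finset.range (2 * m + 1)).image f = Finset.univ := by
    rw [← Finset.card_eq_iff_eq_univ, S11.card_image hf.1, hcard]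
  have hsurj : ∀ u, ∃ i, i ≤ 2 * m ∧ f i = u := by
    intro u
    have : u ∈ (Finset.range (2 * m + 1)).image f := by rw [huniv]; simp
    rw [Finset.mem_image] at this
    obtain ⟨i, hi, e⟩ := this
    rw [Finset.mem_range] at hi
    exact ⟨i, by omega, e⟩
  have hA : ∀ i, i ≤ 2 * m → (f i ∈ f '' Set.Ico 0 m ↔ i < m) := by
    intro i hi
    constructor
    · rintro ⟨j, ⟨-, hj⟩, e⟩
      rw [hinj j i (by omega) hi] at e
      omega
    · intro h
      exact ⟨i, ⟨Nat.zero_le _, h⟩, rfl⟩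
  have hB : ∀ i, i ≤ 2 * m → (f i ∈ f '' Set.Ioc m (2 * m) ↔ m < i) := by
    intro i hi
    constructor
    · rintro ⟨j, ⟨hj, hj'⟩, e⟩
      rw [hinj j i hj' hi] at e
      omega
    · intro h
      exact ⟨i, ⟨h, hi⟩, rfl⟩
  refine ⟨f m, f '' Set.Ico 0 m, f '' Set.Ioc m (2 * m), ?_, ?_, ?_, ?_, ?_⟩
  · rw [Set.disjoint_left]
    intro x hx hx'
    obtain ⟨i, hi, rfl⟩ := hsurj x
    rw [hA i hi] at hx
    rw [hB i hi] at hx'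
    omega
  · ext x
    obtain ⟨i, hi, rfl⟩ := hsurj x
    rw [Set.mem_union, hA i hi, hB i hi, Set.mem_sdiff, Set.mem_singleton_iff,
      hinj i m hi (by omega)]
    simp only [Set.mem_univ, true_and]
    omega
  · rw [Set.ncard_image_of_injOn]
    · rw [← Finset.coe_Ico, Set.ncard_coe_finset]; simp
    · intro x hx y hy e
      simp only [Set.mem_Ico] at hx hy
      exact (hinj x y (by omega) (by omega)).1 e
  · rw [Set.ncard_image_of_injOn]
    · rw [← Finset.coe_Ioc, Set.ncard_coe_finset]; simp; omega
    · intro x hx y hy e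
      simp only [Set.mem_Ioc] at hx hy
      exact (hinj x y (by omega) (by omega)).1 e
  · intro x y
    obtain ⟨i, hi, rfl⟩ := hsurj x
    obtain ⟨j, hj, rfl⟩ := hsurj y
    rw [hadj i j hi hj, hA i hi, hA j hj, hB i hi, hB j hj, Ne, Ne, hinj i j hi hj,
      hinj i m hi (by omega), hinj j m hj (by omega)]
end

section
/- For sufficiently large even n, let G be an n-vertex graph with δ(G) ≥ n/2 - 1 that contains no Hamilton cycle. Then G is a spanning subgraph of K_1 ∨ (K_{n/2-1} ∪ K_{n/2}) or a spanning subgraph of (K_2 ∪ (n/2 - 1)·K_1) ∨ K_{n/2-1}. -/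
open SimpleGraph

/-- An injective enumeration of `m` vertices in which consecutive vertices are adjacent. -/
def HP {V : Type} (G : SimpleGraph V) (m : ℕ) (f : ℕ → V) : Prop :=
  (∀ i j, i < m → j < m → f i = f j → i = j) ∧ ∀ i, i + 1 < m → G.Adj (f i) (f (i + 1))

/-- A closed version of `HP`, i.e. a cycle on `m` vertices. -/
def CycN {V : Type} (G : SimpleGraph V) (m : ℕ) (f : ℕ → V) : Prop :=
  HP G m f ∧ G.Adj (f (m - 1)) (f 0)

/-- A cycle on `m` vertices, indexed by `ZMod m`. -/
def ZCyc {V : Type} (G : SimpleGraph V) (m : ℕ) (c : ZMod m → V) : Prop :=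
  (∀ x y, c x = c y → x = y) ∧ ∀ x, G.Adj (c x) (c (x + 1))

/-- First alternative. -/
def C1 {V : Type} (G : SimpleGraph V) (n : ℕ) : Prop :=
  ∃ (u : V) (A B : Set V), Disjoint A B ∧ A ∪ B = Set.univ \ {u} ∧
            A.ncard = n / 2 - 1 ∧ B.ncard = n / 2 ∧
            ∀ x y, G.Adj x y →
              (x = u ∨ y = u ∨ (x ∈ A ∧ y ∈ A) ∨ (x ∈ B ∧ y ∈ B))

/-- Second alternative. -/
def C2 {V : Type} (G : SimpleGraph V) (n : ℕ) : Prop :=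
  ∃ (W : Set V) (a b : V), W.ncard = n / 2 - 1 ∧ a ≠ b ∧ a ∉ W ∧ b ∉ W ∧
              ∀ x y, G.Adj x y →
                (x ∈ W ∨ y ∈ W ∨ (x = a ∧ y = b) ∨ (x = b ∧ y = a))

lemma deg_le_of {V : Type} {G : SimpleGraph V} (v : V) (T : Finset V)
    (h : ∀ w, G.Adj v w → w ∈ T) : deg G v ≤ T.card := by
  unfold deg
  rw [← Set.ncard_coe_finset]
  exact Set.ncard_le_ncard (fun w hw => h w hw) (Finset.finite_toSet T)

lemma HP_surj {V : Type} [Fintype V] [DecidableEq V] {G : SimpleGraph V} {n : ℕ} {f : ℕ → V}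
    (hcard : Fintype.card V = n) (h : HP G n f) (v : V) : ∃ i, i < n ∧ f i = v := by
  have h1 : ((Finset.range n).image f).card = Fintype.card V := by
    rw [Finset.card_image_of_injOn, Finset.card_range, hcard]
    intro i hi j hj hij
    exact h.1 i j (by simpa using hi) (by simpa using hj) hij
  have h2 := (Finset.card_eq_iff_eq_univ _).1 h1
  have h3 : v ∈ (Finset.range n).image f := by rw [h2]; simp
  simpa using h3

lemma deg_count {V : Type} [Fintype V] [DecidableEq V] {G : SimpleGraph V} {n : ℕ} {f : ℕ → V}
    (hcard : Fintype.card V = n) (h : HP G n f) (v : V) (S : Finset ℕ)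
    (hS : ∀ j, j < n → G.Adj v (f j) → j ∈ S) : deg G v ≤ S.card := by
  refine (deg_le_of v (S.image f) ?_).trans Finset.card_image_le
  intro w hw
  obtain ⟨i, hi, rfl⟩ := HP_surj hcard h w
  exact Finset.mem_image_of_mem _ (hS i hi hw)

/-- A cycle through all vertices gives a Hamiltonian cycle in the sense of Mathlib. -/
lemma ham_of_cyc {V : Type} [Fintype V] [DecidableEq V] {G : SimpleGraph V} {n : ℕ} {f : ℕ → V}
    (hcard : Fintype.card V = n) (hn : 3 ≤ n) (h : CycN G n f) :
    ∃ (v : V) (p : G.Walk v v), p.IsHamiltonianCycle := by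
  obtain ⟨⟨hinj, hadj⟩, hcl⟩ := h
  have key : ∀ u v : Fin n, (v - u).val = 1 → G.Adj (f u) (f v) := by
    intro u v huv
    have hu := u.2
    have hv := v.2
    rw [Fin.sub_def] at huv
    simp only at huv
    by_cases huv' : u.val ≤ v.val
    · have : (n - u.val + v.val) % n = v.val - u.val := by
        rw [show n - u.val + v.val = (v.val - u.val) + n by omega, Nat.add_mod_right,
          Nat.mod_eq_of_lt (by omega)]
      have e : v.val = u.val + 1 := by omega
      rw [e]; exact hadj _ (by omega)
    · have : (n - u.val + v.val) % n = n - u.val + v.val := Nat.mod_eq_of_lt (by omega)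
      have e1 : v.val = 0 := by omega
      have e2 : u.val = n - 1 := by omega
      rw [e1, e2]; exact hcl
  have hcopy : cycleGraph n ⊑ G := by
    refine ⟨⟨⟨fun u => f u, ?_⟩, ?_⟩⟩
    · intro u v huv
      rcases cycleGraph_adj'.1 huv with h | h
      · exact (key _ _ h).symm
      · exact key _ _ h
    · intro u v huv
      exact Fin.ext (hinj _ _ u.2 v.2 huv)
  obtain ⟨v, p, hp, hl⟩ := (cycleGraph_isContained_iff (by omega)).1 hcopy
  refine ⟨v, p, hp, ?_⟩
  rw [Walk.isHamiltonian_iff_isPath_and_length_eq]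
  have := Walk.length_tail_add_one hp.not_nil
  exact ⟨hp.isPath_tail, by omega⟩

lemma crossCyc {V : Type} {G : SimpleGraph V} {n : ℕ} {f : ℕ → V} (h : HP G n f) (i j : ℕ)
    (hij : i < j) (hj : j < n) (h1 : G.Adj (f i) (f (n - 1))) (h2 : G.Adj (f 0) (f j)) :
    CycN G (n + i + 1 - j) (fun l => if l ≤ i then f l else f (n + i - l)) := by
  refine ⟨⟨?_, ?_⟩, ?_⟩
  · intro a b ha hb hab
    simp only at hab
    split_ifs at hab
    · exact h.1 _ _ (by omega) (by omega) hab
    · have := h.1 _ _ (by omega) (by omega) hab; omega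
    · have := h.1 _ _ (by omega) (by omega) hab; omega
    · have := h.1 _ _ (by omega) (by omega) hab; omega
  · intro a ha
    by_cases h3 : a + 1 ≤ i
    · simp only [h3, if_true, show a ≤ i by omega]
      exact h.2 _ (by omega)
    · by_cases h4 : a ≤ i
      · have : a = i := by omega
        subst this
        simp only [le_refl, if_true, h3, if_false]
        rw [show n + a - (a + 1) = n - 1 by omega]
        exact h1
      · simp only [h3, h4, if_false]
        rw [show n + i - a = (n + i - (a + 1)) + 1 by omega]
        exact (h.2 _ (by omega)).symm
  · simp only [Nat.zero_le, if_true]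
    rw [if_neg (by omega), show n + i - (n + i + 1 - j - 1) = j by omega]
    exact h2.symm

lemma posa {V : Type} {G : SimpleGraph V} {n : ℕ} {f : ℕ → V} (h : HP G n f) (i : ℕ)
    (hj : i + 1 < n) (h1 : G.Adj (f i) (f (n - 1))) (h2 : G.Adj (f 0) (f (i + 1))) :
    ∃ g, CycN G n g := by
  have := crossCyc h i (i + 1) (by omega) hj h1 h2
  rw [show n + i + 1 - (i + 1) = n by omega] at this
  exact ⟨_, this⟩

lemma cyc_toZ {V : Type} {G : SimpleGraph V} {m : ℕ} {f : ℕ → V} (hm : 2 ≤ m) (h : CycN G m f) :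
    ZCyc G m (fun x => f x.val) := by
  have : NeZero m := ⟨by omega⟩
  have : Fact (1 < m) := ⟨by omega⟩
  refine ⟨fun x y hxy => ZMod.val_injective m (h.1.1 _ _ (ZMod.val_lt x) (ZMod.val_lt y) hxy), ?_⟩
  intro x
  have hx := ZMod.val_lt x
  have h1 : (x + 1).val = (x.val + 1) % m := by rw [ZMod.val_add, ZMod.val_one]
  show G.Adj (f x.val) (f (x + 1).val)
  rw [h1]
  by_cases h2 : x.val + 1 = m
  · rw [h2, Nat.mod_self, show x.val = m - 1 by omega]
    exact h.2
  · rw [Nat.mod_eq_of_lt (by omega)]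
    exact h.1.2 _ (by omega)

lemma natCast_inj_of_lt {m i j : ℕ} (hi : i < m) (hj : j < m) (h : (i : ZMod m) = j) : i = j := by
  rw [ZMod.natCast_eq_natCast_iff'] at h
  rwa [Nat.mod_eq_of_lt hi, Nat.mod_eq_of_lt hj] at h

lemma Zpath {V : Type} {G : SimpleGraph V} {m : ℕ} {c : ZMod m → V} (h : ZCyc G m c)
    (s : ZMod m) : HP G m (fun i => c (s + i)) := by
  refine ⟨fun i j hi hj hij => ?_, fun i hi => ?_⟩
  · exact natCast_inj_of_lt hi hj (add_left_cancel (h.1 _ _ hij))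
  · have := h.2 (s + i)
    simpa [add_assoc] using this

lemma Zrev {V : Type} {G : SimpleGraph V} {m : ℕ} {c : ZMod m → V} (h : ZCyc G m c) :
    ZCyc G m (fun x => c (-x)) := by
  refine ⟨fun i j hij => neg_injective (h.1 _ _ hij), fun x => ?_⟩
  have := h.2 (-(x + 1))
  simpa [add_assoc] using this.symm

lemma castpred {m : ℕ} (hm : 1 ≤ m) : ((m - 1 : ℕ) : ZMod m) = -1 := by
  rw [Nat.cast_sub hm]; simp

lemma HP_append {V : Type} {G : SimpleGraph V} {m : ℕ} {f : ℕ → V} (hm : 1 ≤ m) (h : HP G m f)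
    (z : V) (hz : ∀ i, i < m → f i ≠ z) (hadj : G.Adj (f (m - 1)) z) :
    HP G (m + 1) (fun i => if i < m then f i else z) := by
  refine ⟨fun i j hi hj hij => ?_, fun i hi => ?_⟩
  · simp only at hij
    split_ifs at hij with h1 h2 h2
    · exact h.1 _ _ h1 h2 hij
    · exact absurd hij (hz _ h1)
    · exact absurd hij.symm (hz _ h2)
    · omega
  · have h1 : i < m := by omega
    simp only [h1, if_true]
    by_cases h2 : i + 1 < m
    · simp only [h2, if_true]; exact h.2 _ h2
    · simp only [h2, if_false]
      rw [show i = m - 1 by omega]; exact hadj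

set_option linter.unusedSectionVars false

section cycles
variable {V : Type} [Fintype V] [DecidableEq V] {G : SimpleGraph V}

lemma cyc1_path {m : ℕ} (hm : 2 ≤ m) {c : ZMod m → V} (h : ZCyc G m c) {z : V}
    (hz : ∀ x, c x ≠ z) (x : ZMod m) (hx : G.Adj z (c x)) :
    HP G (m + 1) (fun i => if i < m then c (x + 1 + i) else z) := by
  refine HP_append (by omega) (Zpath h (x + 1)) z (fun i _ => hz _) ?_
  rw [castpred (by omega), add_neg_cancel_right]
  exact hx.symm

lemma cyc1_nonconsec {m : ℕ} (hm : 2 ≤ m) {c : ZMod m → V} (h : ZCyc G m c) {z : V}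
    (hz : ∀ x, c x ≠ z) (x : ZMod m) (hx : G.Adj z (c x)) (hx' : G.Adj z (c (x + 1))) :
    ∃ g, CycN G (m + 1) g := by
  refine ⟨_, cyc1_path hm h hz x hx, ?_⟩
  simp [show 0 < m by omega, hx']

lemma cyc1_indep {m : ℕ} (hm : 2 ≤ m) {c : ZMod m → V} (h : ZCyc G m c) {z : V}
    (hz : ∀ x, c x ≠ z) (hno : ¬ ∃ g, CycN G (m + 1) g) (x y : ZMod m) (hx : G.Adj z (c x))
    (hy : G.Adj z (c y)) : ¬ G.Adj (c (x + 1)) (c (y + 1)) := by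
  intro hadj
  have : NeZero m := ⟨by omega⟩
  have hxy : x ≠ y := by rintro rfl; exact G.loopless.irrefl _ hadj
  have hi := ZMod.val_lt (y - x - 1)
  have hi' : ((y - x - 1).val : ZMod m) = y - x - 1 := ZMod.natCast_zmod_val _
  have hi2 : (y - x - 1).val + 1 < m := by
    by_contra hcon
    have e : (y - x - 1).val = m - 1 := by omega
    rw [e, castpred (by omega)] at hi'
    apply hxy
    linear_combination hi'
  apply hno
  refine posa (cyc1_path hm h hz x hx) (y - x - 1).val (by omega) ?_ ?_
  · simp only [hi, if_true, Nat.add_sub_cancel, lt_irrefl, if_false, hi']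
    rw [show x + 1 + (y - x - 1) = y by ring]
    exact hy.symm
  · simp only [hi2, if_true, show 0 < m by omega, Nat.cast_zero, add_zero, Nat.cast_add, hi',
      Nat.cast_one]
    rw [show x + 1 + (y - x - 1 + 1) = y + 1 by ring]
    exact hadj

lemma cyc1_indep' {m : ℕ} (hm : 2 ≤ m) {c : ZMod m → V} (h : ZCyc G m c) {z : V}
    (hz : ∀ x, c x ≠ z) (hno : ¬ ∃ g, CycN G (m + 1) g) (x y : ZMod m) (hx : G.Adj z (c x))
    (hy : G.Adj z (c y)) : ¬ G.Adj (c (x - 1)) (c (y - 1)) := by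
  have := cyc1_indep hm (Zrev h) (z := z) (fun x => hz _) hno (-x) (-y) (by simpa using hx)
    (by simpa using hy)
  simpa [sub_eq_add_neg, add_comm] using this

lemma cyc1 {k : ℕ} (hk : 2 ≤ k) (hcard : Fintype.card V = 2 * k) (hdeg : ∀ v, k ≤ deg G v + 1)
    (hno : ¬ ∃ g, CycN G (2 * k) g) {m : ℕ} (hm : m + 1 = 2 * k)
    {c : ZMod m → V} (h : ZCyc G m c) {z : V} (hz : ∀ x, c x ≠ z) : C2 G (2 * k) := by
  classical
  have : NeZero m := ⟨by omega⟩
  have hno' : ¬ ∃ g, CycN G (m + 1) g := by rwa [hm]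
  have hm2 : 2 ≤ m := by omega
  have hinj : Function.Injective c := fun x y => h.1 x y
  have hsurj : ∀ v, v ≠ z → ∃ x, c x = v := by
    have h1 : (insert z (Finset.univ.image c)).card = Fintype.card V := by
      rw [Finset.card_insert_of_notMem (by simpa using hz), Finset.card_image_of_injective _ hinj,
        Finset.card_univ, ZMod.card, hcard, hm]
    have h2 := (Finset.card_eq_iff_eq_univ _).1 h1
    intro v hv
    have h3 : v ∈ insert z (Finset.univ.image c) := by rw [h2]; simp
    simpa [hv] using h3
  let N : Finset (ZMod m) := Finset.univ.filter (fun x => G.Adj z (c x))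
  have hN : ∀ x, x ∈ N ↔ G.Adj z (c x) := by simp [N]
  have hN1 : k ≤ N.card + 1 := by
    have := deg_le_of (G := G) z (N.image c) (by
      intro w hw
      obtain ⟨x, rfl⟩ := hsurj w hw.ne'
      exact Finset.mem_image_of_mem _ ((hN x).2 hw))
    have h2 := Finset.card_image_le (s := N) (f := c)
    have := hdeg z
    omega
  have hcons : ∀ x, x ∈ N → x + 1 ∉ N := by
    intro x hx hx'
    exact hno' (cyc1_nonconsec hm2 h hz x ((hN x).1 hx) ((hN _).1 hx'))
  let N' : Finset (ZMod m) := N.image (fun x => x + 1)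
  have hN'c : N'.card = N.card := Finset.card_image_of_injective _ (add_left_injective 1)
  have hN' : ∀ x, x ∈ N' ↔ x - 1 ∈ N := by
    intro x
    simp only [N', Finset.mem_image]
    constructor
    · rintro ⟨y, hy, rfl⟩; simpa using hy
    · intro hy; exact ⟨_, hy, by ring⟩
  let N'' : Finset (ZMod m) := N.image (fun x => x - 1)
  have hN''c : N''.card = N.card := Finset.card_image_of_injective _ (sub_left_injective)
  have hN'' : ∀ x, x ∈ N'' ↔ x + 1 ∈ N := by
    intro x
    simp only [N'', Finset.mem_image]
    constructor
    · rintro ⟨y, hy, rfl⟩; simpa using hy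
    · intro hy; exact ⟨_, hy, by ring⟩
  have hd1 : Disjoint N N' := by
    rw [Finset.disjoint_left]
    intro x hx hx'
    exact hcons _ ((hN' x).1 hx') (by simpa using hx)
  have hd2 : Disjoint N N'' := by
    rw [Finset.disjoint_left]
    intro x hx hx'
    exact hcons _ hx ((hN'' x).1 hx')
  have hu1 : (N ∪ N').card = N.card + N.card := by rw [Finset.card_union_of_disjoint hd1, hN'c]
  have hu2 : (N ∪ N'').card = N.card + N.card := by rw [Finset.card_union_of_disjoint hd2, hN''c]
  have hle : (N ∪ N').card ≤ m := by
    have := Finset.card_le_univ (N ∪ N'); rwa [ZMod.card] at this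
  have hNk : N.card + 1 = k := by omega
  have hc1 : ((N ∪ N')ᶜ).card = 1 := by rw [Finset.card_compl, ZMod.card]; omega
  have hc2 : ((N ∪ N'')ᶜ).card = 1 := by rw [Finset.card_compl, ZMod.card]; omega
  obtain ⟨a, ha⟩ := Finset.card_eq_one.1 hc1
  obtain ⟨b, hb⟩ := Finset.card_eq_one.1 hc2
  have ha' : ∀ x, x ∉ N → x - 1 ∉ N → x = a := by
    intro x h1 h2
    have : x ∈ (N ∪ N')ᶜ := by
      simp only [Finset.mem_compl, Finset.mem_union, hN']; tauto
    rw [ha] at this; simpa using this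
  have hb' : ∀ x, x ∉ N → x + 1 ∉ N → x = b := by
    intro x h1 h2
    have : x ∈ (N ∪ N'')ᶜ := by
      simp only [Finset.mem_compl, Finset.mem_union, hN'']; tauto
    rw [hb] at this; simpa using this
  have haa : a ∉ N ∧ a - 1 ∉ N := by
    have : a ∈ (N ∪ N')ᶜ := by rw [ha]; simp
    simp only [Finset.mem_compl, Finset.mem_union, hN'] at this; tauto
  have hbb : b ∉ N ∧ b + 1 ∉ N := by
    have : b ∈ (N ∪ N'')ᶜ := by rw [hb]; simp
    simp only [Finset.mem_compl, Finset.mem_union, hN''] at this; tauto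
  have hone : (1 : ZMod m) ≠ 0 := by
    have : Fact (1 < m) := ⟨by omega⟩
    exact one_ne_zero
  have hab : a ≠ b := by
    rintro rfl
    have := ha' (a + 1) hbb.2 (by simpa using haa.1)
    apply hone
    linear_combination this
  have hcab : c a ≠ c b := fun e => hab (h.1 _ _ e)
  have hmemW : ∀ x, c x ∈ ((N.image c : Finset V) : Set V) ↔ x ∈ N := by
    intro x
    simp only [Finset.coe_image, Set.mem_image, Finset.mem_coe]
    constructor
    · rintro ⟨y, hy, e⟩; rwa [← h.1 _ _ e]
    · intro hx; exact ⟨x, hx, rfl⟩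
  refine ⟨((N.image c : Finset V) : Set V), c a, c b, ?_, hcab, ?_, ?_, ?_⟩
  · rw [Set.ncard_coe_finset, Finset.card_image_of_injective _ hinj]; omega
  · rw [hmemW]; exact haa.1
  · rw [hmemW]; exact hbb.1
  · intro v w hvw
    by_cases hv : v = z
    · subst hv
      obtain ⟨x, rfl⟩ := hsurj w hvw.ne'
      right; left
      rw [hmemW, hN]; exact hvw
    by_cases hw : w = z
    · subst hw
      obtain ⟨x, rfl⟩ := hsurj v hvw.ne
      left
      rw [hmemW, hN]; exact hvw.symm
    obtain ⟨x, rfl⟩ := hsurj v hv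
    obtain ⟨y, rfl⟩ := hsurj w hw
    rw [hmemW, hmemW]
    by_cases hx : x ∈ N
    · exact Or.inl hx
    by_cases hy : y ∈ N
    · exact Or.inr (Or.inl hy)
    right; right
    have hxy : x ≠ y := fun e => hvw.ne (by rw [e])
    have e1 : x = a ∨ y = a := by
      by_contra hcon
      push Not at hcon
      have i1 : x - 1 ∈ N := by by_contra hh; exact hcon.1 (ha' x hx hh)
      have i2 : y - 1 ∈ N := by by_contra hh; exact hcon.2 (ha' y hy hh)
      have := cyc1_indep hm2 h hz hno' _ _ ((hN _).1 i1) ((hN _).1 i2)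
      simp only [sub_add_cancel] at this
      exact this hvw
    have e2 : x = b ∨ y = b := by
      by_contra hcon
      push Not at hcon
      have i1 : x + 1 ∈ N := by by_contra hh; exact hcon.1 (hb' x hx hh)
      have i2 : y + 1 ∈ N := by by_contra hh; exact hcon.2 (hb' y hy hh)
      have := cyc1_indep' hm2 h hz hno' _ _ ((hN _).1 i1) ((hN _).1 i2)
      simp only [add_sub_cancel_right] at this
      exact this hvw
    rcases e1 with rfl | rfl <;> rcases e2 with rfl | rfl
    · exact absurd rfl hab
    · left; exact ⟨rfl, rfl⟩
    · right; exact ⟨rfl, rfl⟩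
    · exact absurd rfl hab

lemma cyc1N {k : ℕ} (hk : 2 ≤ k) (hcard : Fintype.card V = 2 * k)
    (hdeg : ∀ v, k ≤ deg G v + 1) (hno : ¬ ∃ g, CycN G (2 * k) g) {m : ℕ} (hm : m + 1 = 2 * k)
    {f : ℕ → V} (h : CycN G m f) : C2 G (2 * k) := by
  have hlt : ((Finset.range m).image f).card < (Finset.univ : Finset V).card := by
    have := Finset.card_image_le (s := Finset.range m) (f := f)
    rw [Finset.card_range] at this
    rw [Finset.card_univ]; omega
  obtain ⟨z, -, hz⟩ := Finset.exists_mem_notMem_of_card_lt_card hlt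
  have : NeZero m := ⟨by omega⟩
  refine cyc1 hk hcard hdeg hno hm (cyc_toZ (by omega) h) (z := z) ?_
  intro x e
  exact hz (Finset.mem_image.2 ⟨x.val, by simpa using ZMod.val_lt x, e⟩)

/-- Facts on an `m`-cycle with an edge `z w` outside it. -/
lemma cyc2_dist1 {m : ℕ} (hm : 3 ≤ m) {c : ZMod m → V} (h : ZCyc G m c) {z w : V}
    (hz : ∀ x, c x ≠ z) (hw : ∀ x, c x ≠ w) (hzw : G.Adj z w) (x : ZMod m)
    (hx : G.Adj z (c x)) (hx' : G.Adj w (c (x + 1))) : ∃ g, CycN G (m + 2) g := by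
  have h1 := HP_append (by omega) (cyc1_path (by omega) h hz x hx) w (by
    intro i hi
    split_ifs
    · exact hw _
    · exact hzw.ne) (by simpa using hzw)
  refine ⟨_, h1, ?_⟩
  simp [show 0 < m by omega, hx']

lemma cyc2_dist2 {m : ℕ} (hm : 3 ≤ m) {c : ZMod m → V} (h : ZCyc G m c) {z w : V}
    (hz : ∀ x, c x ≠ z) (hw : ∀ x, c x ≠ w) (hzw : G.Adj z w) (x : ZMod m)
    (hx : G.Adj z (c x)) (hx' : G.Adj w (c (x + 2))) : ∃ g, CycN G (m + 1) g := by
  have h0 := Zpath h (x + 2)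
  have h0' : HP G (m - 1) (fun i : ℕ => c (x + 2 + i)) :=
    ⟨fun i j hi hj => h0.1 i j (by omega) (by omega), fun i hi => h0.2 i (by omega)⟩
  have h1 := HP_append (by omega) h0' z (fun i _ => hz _) (by
    have e : ((m - 1 - 1 : ℕ) : ZMod m) = -2 := by
      rw [Nat.cast_sub (by omega), castpred (by omega)]; push_cast; ring
    rw [e, add_neg_cancel_right]; exact hx.symm)
  have h2 := HP_append (by omega) h1 w (by
    intro i hi
    split_ifs
    · exact hw _
    · exact hzw.ne) (by simpa using hzw)
  rw [show m - 1 + 1 + 1 = m + 1 by omega] at h2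
  refine ⟨_, h2, ?_⟩
  simp [show 1 < m by omega, show 0 < m by omega, hx', show m - 1 + 1 = m by omega]

lemma cyc2 {k : ℕ} (hk : 7 ≤ k) (hcard : Fintype.card V = 2 * k) (hdeg : ∀ v, k ≤ deg G v + 1)
    (hno : ¬ ∃ g, CycN G (2 * k) g) {m : ℕ} (hm : m + 2 = 2 * k)
    {c : ZMod m → V} (h : ZCyc G m c) {z w : V} (hz : ∀ x, c x ≠ z) (hw : ∀ x, c x ≠ w)
    (hzw : G.Adj z w) : C2 G (2 * k) := by
  classical
  by_contra hC
  have hno1 : ¬ ∃ g, CycN G (m + 1) g := by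
    rintro ⟨g, hg⟩
    exact hC (cyc1N (by omega) hcard hdeg hno (by omega) hg)
  have hno2 : ¬ ∃ g, CycN G (m + 2) g := by rwa [hm]
  have : NeZero m := ⟨by omega⟩
  have hm3 : 3 ≤ m := by omega
  have hinj : Function.Injective c := fun x y => h.1 x y
  have hsurj : ∀ v, v ≠ z → v ≠ w → ∃ x, c x = v := by
    have h1 : (insert w (insert z (Finset.univ.image c))).card = Fintype.card V := by
      rw [Finset.card_insert_of_notMem (by simpa using ⟨hzw.ne', hw⟩),
        Finset.card_insert_of_notMem (by simpa using hz), Finset.card_image_of_injective _ hinj,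
        Finset.card_univ, ZMod.card, hcard]; omega
    have h2 := (Finset.card_eq_iff_eq_univ _).1 h1
    intro v hv hv'
    have h3 : v ∈ insert w (insert z (Finset.univ.image c)) := by rw [h2]; simp
    simpa [hv, hv'] using h3
  let N : V → Finset (ZMod m) := fun v => Finset.univ.filter (fun x => G.Adj v (c x))
  have hN : ∀ v x, x ∈ N v ↔ G.Adj v (c x) := by simp [N]
  have hNz : k ≤ (N z).card + 2 := by
    have := deg_le_of (G := G) z (insert w ((N z).image c)) (by
      intro v hv
      by_cases hvw : v = w
      · simp [hvw]
      obtain ⟨x, rfl⟩ := hsurj v hv.ne' hvw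
      exact Finset.mem_insert_of_mem (Finset.mem_image_of_mem _ ((hN _ x).2 hv)))
    have h2 := Finset.card_image_le (s := N z) (f := c)
    have h3 := Finset.card_insert_le w ((N z).image c)
    have := hdeg z
    omega
  have hNw : k ≤ (N w).card + 2 := by
    have := deg_le_of (G := G) w (insert z ((N w).image c)) (by
      intro v hv
      by_cases hvw : v = z
      · simp [hvw]
      obtain ⟨x, rfl⟩ := hsurj v hvw hv.ne'
      exact Finset.mem_insert_of_mem (Finset.mem_image_of_mem _ ((hN _ x).2 hv)))
    have h2 := Finset.card_image_le (s := N w) (f := c)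
    have h3 := Finset.card_insert_le z ((N w).image c)
    have := hdeg w
    omega
  have hcons : ∀ x, x ∈ N z → x + 1 ∉ N z := by
    intro x hx hx'
    exact hno1 (cyc1_nonconsec (by omega) h hz x ((hN _ x).1 hx) ((hN _ _).1 hx'))
  let N' : Finset (ZMod m) := (N z).image (fun x => x + 1)
  have hN'c : N'.card = (N z).card := Finset.card_image_of_injective _ (add_left_injective 1)
  have hN' : ∀ x, x ∈ N' ↔ x - 1 ∈ N z := by
    intro x
    simp only [N', Finset.mem_image]
    constructor
    · rintro ⟨y, hy, rfl⟩; simpa using hy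
    · intro hy; exact ⟨_, hy, by ring⟩
  have hd1 : Disjoint (N z) N' := by
    rw [Finset.disjoint_left]
    intro x hx hx'
    exact hcons _ ((hN' x).1 hx') (by simpa using hx)
  have hu1 : (N z ∪ N').card = (N z).card + (N z).card := by
    rw [Finset.card_union_of_disjoint hd1, hN'c]
  let R : Finset (ZMod m) := (N z ∪ N')ᶜ
  have hR : R.card ≤ 2 := by
    simp only [R]
    rw [Finset.card_compl, ZMod.card]; omega
  have hsub : N w ⊆ R ∪ R.image (fun x => x - 2) := by
    intro x hx
    rw [Finset.mem_union]
    have hx1 : x - 1 ∉ N z := by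
      intro h1
      refine hno2 (cyc2_dist1 hm3 h hz hw hzw (x - 1) ((hN _ _).1 h1) ?_)
      rw [sub_add_cancel]; exact (hN _ _).1 hx
    by_cases hxz : x ∈ N z
    · right
      rw [Finset.mem_image]
      refine ⟨x + 2, ?_, by ring⟩
      simp only [R, Finset.mem_compl, Finset.mem_union, hN', not_or]
      constructor
      · intro h2
        exact hno1 (cyc2_dist2 hm3 h hw hz hzw.symm x ((hN _ _).1 hx) ((hN _ _).1 h2))
      · rw [show x + 2 - 1 = x + 1 by ring]
        exact hcons x hxz
    · left
      simp only [R, Finset.mem_compl, Finset.mem_union, hN', not_or]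
      exact ⟨hxz, hx1⟩
  have e1 := Finset.card_le_card hsub
  have e2 := Finset.card_union_le R (R.image (fun x => x - 2))
  have e3 := Finset.card_image_le (s := R) (f := fun x => x - 2)
  omega

/-- At most one index is missed. -/
lemma miss {k : ℕ} (hk : 7 ≤ k) (hcard : Fintype.card V = 2 * k) (hdeg : ∀ v, k ≤ deg G v + 1)
    (hno : ¬ ∃ g, CycN G (2 * k) g) {f : ℕ → V} (hf : HP G (2 * k) f)
    (hend : ¬ G.Adj (f 0) (f (2 * k - 1))) (a b : ℕ) (hab : a < b) (hb : b + 1 < 2 * k)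
    (ha1 : ¬ G.Adj (f 0) (f (a + 1))) (ha2 : ¬ G.Adj (f (2 * k - 1)) (f a))
    (hb1 : ¬ G.Adj (f 0) (f (b + 1))) (hb2 : ¬ G.Adj (f (2 * k - 1)) (f b)) : False := by
  classical
  let A := (Finset.range (2 * k - 1)).filter (fun i => G.Adj (f 0) (f (i + 1)))
  let B := (Finset.range (2 * k - 1)).filter (fun i => G.Adj (f (2 * k - 1)) (f i))
  have hA : k ≤ A.card + 1 := by
    have h1 := deg_count hcard hf (f 0) (A.image (fun i => i + 1)) (by
      intro j hj hadj
      rw [Finset.mem_image]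
      have : j ≠ 0 := by rintro rfl; exact G.loopless.irrefl _ hadj
      refine ⟨j - 1, ?_, by omega⟩
      simp only [A, Finset.mem_filter, Finset.mem_range]
      rw [show j - 1 + 1 = j by omega]
      exact ⟨by omega, hadj⟩)
    have h2 := Finset.card_image_le (s := A) (f := fun i => i + 1)
    have := hdeg (f 0)
    omega
  have hB : k ≤ B.card + 1 := by
    have h1 := deg_count hcard hf (f (2 * k - 1)) B (by
      intro j hj hadj
      simp only [B, Finset.mem_filter, Finset.mem_range]
      have : j ≠ 2 * k - 1 := by rintro rfl; exact G.loopless.irrefl _ hadj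
      exact ⟨by omega, hadj⟩)
    have := hdeg (f (2 * k - 1))
    omega
  have hd : Disjoint A B := by
    rw [Finset.disjoint_left]
    intro i h1 h2
    simp only [A, B, Finset.mem_filter, Finset.mem_range] at h1 h2
    exact hno (posa hf i (by omega) h2.2.symm h1.2)
  have hsub : A ∪ B ⊆ ((Finset.range (2 * k - 1)).erase a).erase b := by
    intro i hi
    simp only [A, B, Finset.mem_union, Finset.mem_filter, Finset.mem_range] at hi
    simp only [Finset.mem_erase, Finset.mem_range]
    refine ⟨?_, ?_, by omega⟩
    · rintro rfl; tauto
    · rintro rfl; tauto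
  have e := Finset.card_le_card hsub
  rw [Finset.card_union_of_disjoint hd, Finset.card_erase_of_mem, Finset.card_erase_of_mem,
    Finset.card_range] at e
  · omega
  · simp; omega
  · simp; omega

/-- Crossing neighbourhoods along a Hamilton path give the second alternative. -/
lemma crossing {k : ℕ} (hk : 7 ≤ k) (hcard : Fintype.card V = 2 * k)
    (hdeg : ∀ v, k ≤ deg G v + 1)
    (hno : ¬ ∃ g, CycN G (2 * k) g) {f : ℕ → V} (hf : HP G (2 * k) f)
    (hend : ¬ G.Adj (f 0) (f (2 * k - 1))) : ∀ (d i : ℕ), i + d < 2 * k → 0 < d →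
    G.Adj (f (2 * k - 1)) (f i) → G.Adj (f 0) (f (i + d)) → C2 G (2 * k) := by
  intro d
  induction d using Nat.strong_induction_on with
  | _ d ih =>
    intro i hid hd h1 h2
    by_cases hy : ∃ l, i < l ∧ l < i + d ∧ G.Adj (f (2 * k - 1)) (f l)
    · obtain ⟨l, hl1, hl2, hl⟩ := hy
      refine ih (i + d - l) (by omega) l (by omega) (by omega) hl ?_
      rwa [show l + (i + d - l) = i + d by omega]
    by_cases hx : ∃ l, i < l ∧ l < i + d ∧ G.Adj (f 0) (f l)
    · obtain ⟨l, hl1, hl2, hl⟩ := hx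
      refine ih (l - i) (by omega) i (by omega) (by omega) h1 ?_
      rwa [show i + (l - i) = l by omega]
    push Not at hx hy
    have hc := crossCyc hf i (i + d) (by omega) hid h1.symm h2
    have hd4 : d ≤ 3 := by
      by_contra hd4
      exact miss hk hcard hdeg hno hf hend (i + 1) (i + 2) (by omega) (by omega)
        (hx _ (by omega) (by omega)) (hy _ (by omega) (by omega))
        (hx _ (by omega) (by omega)) (hy _ (by omega) (by omega))
    obtain rfl | rfl | rfl : d = 1 ∨ d = 2 ∨ d = 3 := by omega
    · rw [show 2 * k + i + 1 - (i + 1) = 2 * k by omega] at hc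
      exact absurd ⟨_, hc⟩ hno
    · exact cyc1N (by omega) hcard hdeg hno (by omega) hc
    · have : NeZero (2 * k + i + 1 - (i + 3)) := ⟨by omega⟩
      have hne : ∀ e, e = i + 1 ∨ e = i + 2 → ∀ x : ZMod (2 * k + i + 1 - (i + 3)),
          (if x.val ≤ i then f x.val else f (2 * k + i - x.val)) ≠ f e := by
        intro e he x heq
        have hx := ZMod.val_lt x
        split_ifs at heq
        · have := hf.1 _ _ (by omega) (by omega) heq; omega
        · have := hf.1 _ _ (by omega) (by omega) heq; omega
      exact cyc2 hk hcard hdeg hno (by omega) (cyc_toZ (by omega) hc) (hne (i + 1) (by omega))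
        (hne (i + 2) (by omega)) (hf.2 (i + 1) (by omega))

lemma HP_rot {n : ℕ} {f : ℕ → V} (hf : HP G n f) (i : ℕ) (hi : i + 1 < n)
    (h : G.Adj (f 0) (f (i + 1))) : HP G n (fun j => if j ≤ i then f (i - j) else f j) := by
  refine ⟨fun a b ha hb hab => ?_, fun a ha => ?_⟩
  · simp only at hab
    split_ifs at hab
    all_goals
      have := hf.1 _ _ (by omega) (by omega) hab
      omega
  · by_cases h1 : a + 1 ≤ i
    · simp only [h1, if_true, show a ≤ i by omega]
      rw [show i - a = i - (a + 1) + 1 by omega]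
      exact (hf.2 _ (by omega)).symm
    · by_cases h2 : a ≤ i
      · have : a = i := by omega
        subst this
        simpa [h1] using h
      · simp only [h1, h2, if_false]
        exact hf.2 _ ha

lemma HP_rev {n : ℕ} {f : ℕ → V} (hf : HP G n f) : HP G n (fun j => f (n - 1 - j)) := by
  refine ⟨fun a b ha hb hab => ?_, fun a ha => ?_⟩
  · have := hf.1 _ _ (by omega) (by omega) hab
    omega
  · simp only
    rw [show n - 1 - a = n - 1 - (a + 1) + 1 by omega]
    exact (hf.2 _ (by omega)).symm

lemma conclude1 {k : ℕ} (hk : 7 ≤ k) (hcard : Fintype.card V = 2 * k) {f : ℕ → V}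
    (hf : HP G (2 * k) f)
    (h : ∀ i j, i + 1 < k → k ≤ j → j < 2 * k → ¬ G.Adj (f i) (f j)) : C1 G (2 * k) := by
  refine ⟨f (k - 1), ((Finset.range (k - 1)).image f : Finset V),
    ((Finset.Ico k (2 * k)).image f : Finset V), ?_, ?_, ?_, ?_, ?_⟩
  · rw [Finset.disjoint_coe, Finset.disjoint_left]
    intro v h1 h2
    simp only [Finset.mem_image, Finset.mem_range, Finset.mem_Ico] at h1 h2
    obtain ⟨i, hi, rfl⟩ := h1
    obtain ⟨j, hj, e⟩ := h2
    have := hf.1 _ _ (by omega) (by omega) e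
    omega
  · ext v
    obtain ⟨i, hi, rfl⟩ := HP_surj hcard hf v
    simp only [Finset.coe_image, Set.mem_union, Set.mem_image, Finset.coe_range, Set.mem_Iio,
      Finset.coe_Ico, Set.mem_Ico, Set.mem_sdiff, Set.mem_univ, true_and, Set.mem_singleton_iff]
    constructor
    · rintro (⟨j, hj, e⟩ | ⟨j, hj, e⟩) e'
      · have := hf.1 _ _ (by omega) (by omega) (e.trans e'); omega
      · have := hf.1 _ _ (by omega) (by omega) (e.trans e'); omega
    · intro hne
      have : i ≠ k - 1 := fun e => hne (by rw [e])
      by_cases hik : i < k - 1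
      · left; exact ⟨i, hik, rfl⟩
      · right; exact ⟨i, by omega, rfl⟩
  · rw [Set.ncard_coe_finset, Finset.card_image_of_injOn, Finset.card_range]
    · omega
    · intro a ha b hb hab
      simp only [Finset.coe_range, Set.mem_Iio] at ha hb
      exact hf.1 _ _ (by omega) (by omega) hab
  · rw [Set.ncard_coe_finset, Finset.card_image_of_injOn, Nat.card_Ico]
    · omega
    · intro a ha b hb hab
      simp only [Finset.coe_Ico, Set.mem_Ico] at ha hb
      exact hf.1 _ _ (by omega) (by omega) hab
  · intro v w hvw
    obtain ⟨i, hi, rfl⟩ := HP_surj hcard hf v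
    obtain ⟨j, hj, rfl⟩ := HP_surj hcard hf w
    by_cases hik : i = k - 1
    · left; rw [hik]
    by_cases hjk : j = k - 1
    · right; left; rw [hjk]
    right; right
    have hi' : i < k - 1 ∨ k ≤ i := by omega
    have hj' : j < k - 1 ∨ k ≤ j := by omega
    rcases hi' with hi' | hi' <;> rcases hj' with hj' | hj'
    · left
      exact ⟨Finset.mem_coe.2 (Finset.mem_image_of_mem _ (Finset.mem_range.2 hi')),
        Finset.mem_coe.2 (Finset.mem_image_of_mem _ (Finset.mem_range.2 hj'))⟩
    · exact absurd hvw (h _ _ (by omega) hj' hj)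
    · exact absurd hvw.symm (h _ _ (by omega) hi' hi)
    · right
      exact ⟨Finset.mem_coe.2 (Finset.mem_image_of_mem _ (Finset.mem_Ico.2 ⟨hi', hi⟩)),
        Finset.mem_coe.2 (Finset.mem_image_of_mem _ (Finset.mem_Ico.2 ⟨hj', hj⟩))⟩

/-- No Hamilton path has crossing neighbourhoods of its (nonadjacent) ends. -/
def NC (G : SimpleGraph V) (n : ℕ) : Prop :=
  ∀ f, HP G n f → ¬ G.Adj (f 0) (f (n - 1)) → ∀ i j, i < j → j < n →
    G.Adj (f (n - 1)) (f i) → ¬ G.Adj (f 0) (f j)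

/-- If all neighbours of the start are among the first `k`, they are exactly these. -/
lemma full_start {k : ℕ} (hcard : Fintype.card V = 2 * k)
    (hdeg : ∀ v, k ≤ deg G v + 1) {f : ℕ → V} (hf : HP G (2 * k) f)
    (h : ∀ j, j < 2 * k → G.Adj (f 0) (f j) → j < k) :
    ∀ i, i + 1 < k → G.Adj (f 0) (f (i + 1)) := by
  intro i hi
  by_contra hcon
  have h1 := deg_count hcard hf (f 0) ((Finset.Ico 1 k).erase (i + 1)) (by
    intro j hj hadj
    have h0 : j ≠ 0 := by rintro rfl; exact G.loopless.irrefl _ hadj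
    have h2 : j ≠ i + 1 := by rintro rfl; exact hcon hadj
    have h3 := h j hj hadj
    simp only [Finset.mem_erase, Finset.mem_Ico]
    omega)
  rw [Finset.card_erase_of_mem (by simp; omega), Nat.card_Ico] at h1
  have := hdeg (f 0)
  omega

/-- Rotation step: the neighbours of early vertices stay early. -/
lemma early {k b : ℕ} (hk : 7 ≤ k) (hNC : NC G (2 * k)) {f : ℕ → V} (hf : HP G (2 * k) f)
    (hend : ¬ G.Adj (f 0) (f (2 * k - 1))) (hfull : ∀ i, i + 1 < k → G.Adj (f 0) (f (i + 1)))
    (hkb : k ≤ b + 1) (hb : b < 2 * k)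
    (hyb : G.Adj (f (2 * k - 1)) (f b)) (i : ℕ) (hi : i + 1 < k) :
    HP G (2 * k) (fun j => if j ≤ i then f (i - j) else f j) ∧
    ¬ G.Adj (f i) (f (2 * k - 1)) ∧ ∀ j, b < j → j < 2 * k → ¬ G.Adj (f i) (f j) := by
  have hr := HP_rot hf i (by omega) (hfull i hi)
  have hne : ¬ G.Adj (f i) (f (2 * k - 1)) := by
    intro hadj
    have h1 := hfull (k - 2) (by omega)
    exact hNC f hf hend i (k - 2 + 1) (by omega) (by omega) hadj.symm h1
  refine ⟨hr, hne, ?_⟩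
  intro j hbj hj hadj
  have := hNC _ hr (by simpa [show ¬ (2 * k - 1 ≤ i) by omega] using hne) b j hbj hj
  simp only [show ¬ (2 * k - 1 ≤ i) by omega, show ¬ (b ≤ i) by omega, show ¬ (j ≤ i) by omega,
    if_false, Nat.zero_le, if_true, Nat.sub_zero] at this
  exact this hyb hadj

lemma caseA {k : ℕ} (hk : 7 ≤ k) (hcard : Fintype.card V = 2 * k)
    (hdeg : ∀ v, k ≤ deg G v + 1) (hNC : NC G (2 * k)) {f : ℕ → V} (hf : HP G (2 * k) f)
    (hend : ¬ G.Adj (f 0) (f (2 * k - 1)))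
    (hy : G.Adj (f (2 * k - 1)) (f (k - 1))) : C1 G (2 * k) := by
  have hfull := full_start hcard hdeg hf (by
    intro j hj hadj
    by_contra hcon
    exact hNC f hf hend (k - 1) j (by omega) hj hy hadj)
  refine conclude1 hk hcard hf ?_
  intro i j hi hkj hj
  exact (early hk hNC hf hend hfull (by omega) (by omega) hy i hi).2.2 j (by omega) hj

lemma caseB {k : ℕ} (hk : 7 ≤ k) (hcard : Fintype.card V = 2 * k)
    (hdeg : ∀ v, k ≤ deg G v + 1) (hNC : NC G (2 * k)) {f : ℕ → V} (hf : HP G (2 * k) f)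
    (hend : ¬ G.Adj (f 0) (f (2 * k - 1)))
    (hx : G.Adj (f 0) (f k)) : C1 G (2 * k) := by
  refine caseA hk hcard hdeg hNC (HP_rev hf) ?_ ?_
  · simp only [Nat.sub_zero, Nat.sub_self]
    exact fun h => hend h.symm
  · simp only [Nat.sub_self]
    rwa [show 2 * k - 1 - (k - 1) = k by omega]

lemma noncrossing {k : ℕ} (hk : 7 ≤ k) (hcard : Fintype.card V = 2 * k)
    (hdeg : ∀ v, k ≤ deg G v + 1) (hNC : NC G (2 * k)) {f : ℕ → V} (hf : HP G (2 * k) f)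
    (hend : ¬ G.Adj (f 0) (f (2 * k - 1))) : C1 G (2 * k) := by
  by_cases hA : G.Adj (f (2 * k - 1)) (f (k - 1))
  · exact caseA hk hcard hdeg hNC hf hend hA
  by_cases hB : G.Adj (f 0) (f k)
  · exact caseB hk hcard hdeg hNC hf hend hB
  obtain ⟨b, hbk, hb⟩ : ∃ b, b ≤ k ∧ G.Adj (f (2 * k - 1)) (f b) := by
    by_contra hcon
    push Not at hcon
    have h1 := deg_count hcard hf (f (2 * k - 1)) (Finset.Ico (k + 1) (2 * k - 1)) (by
      intro j hj hadj
      have h2 : j ≠ 2 * k - 1 := by rintro rfl; exact G.loopless.irrefl _ hadj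
      have h3 : ¬ j ≤ k := fun h => hcon j h hadj
      simp only [Finset.mem_Ico]; omega)
    rw [Nat.card_Ico] at h1
    have := hdeg (f (2 * k - 1))
    omega
  have hbk' : k - 1 ≤ b := by
    have h1 := deg_count hcard hf (f 0) (Finset.Ico 1 (b + 1)) (by
      intro j hj hadj
      have h0 : j ≠ 0 := by rintro rfl; exact G.loopless.irrefl _ hadj
      have h3 : ¬ b < j := fun h => hNC f hf hend b j h hj hb hadj
      simp only [Finset.mem_Ico]; omega)
    rw [Nat.card_Ico] at h1
    have := hdeg (f 0)
    omega
  have hne : b ≠ k - 1 := by rintro rfl; exact hA hb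
  obtain rfl : b = k := by omega
  have hfull := full_start hcard hdeg hf (by
    intro j hj hadj
    by_contra hcon
    have : j ≠ b := by rintro rfl; exact hB hadj
    exact hNC f hf hend b j (by omega) hj hb hadj)
  by_cases hex : ∃ i, i + 1 < b ∧ G.Adj (f i) (f b)
  · obtain ⟨i, hi, hadj⟩ := hex
    obtain ⟨hr, h2, -⟩ := early hk hNC hf hend hfull (by omega) (by omega) hb i hi
    refine caseB hk hcard hdeg hNC hr ?_ ?_
    · simpa [show ¬ (2 * b - 1 ≤ i) by omega] using h2
    · simpa [show ¬ (b ≤ i) by omega] using hadj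
  · push Not at hex
    refine conclude1 hk hcard hf ?_
    intro i j hi hkj hj
    by_cases hjb : j = b
    · rw [hjb]; exact hex i hi
    · exact (early hk hNC hf hend hfull (by omega) (by omega) hb i hi).2.2 j (by omega) hj

/-- Main structural statement for graphs with a Hamilton path with nonadjacent ends. -/
lemma main_path {k : ℕ} (hk : 7 ≤ k) (hcard : Fintype.card V = 2 * k)
    (hdeg : ∀ v, k ≤ deg G v + 1) (hno : ¬ ∃ g, CycN G (2 * k) g) {f : ℕ → V}
    (hf : HP G (2 * k) f) : C1 G (2 * k) ∨ C2 G (2 * k) := by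
  by_cases hNC : NC G (2 * k)
  · left
    exact noncrossing hk hcard hdeg hNC hf (fun h => hno ⟨f, hf, h.symm⟩)
  · right
    unfold NC at hNC
    push Not at hNC
    obtain ⟨g, hg, hend, i, j, hij, hj, h1, h2⟩ := hNC
    refine crossing hk hcard hdeg hno hg hend (j - i) i (by omega) (by omega) h1 ?_
    rwa [show i + (j - i) = j by omega]

/-- A maximal graph without Hamilton cycle has a Hamilton path. -/
lemma exists_path {n : ℕ} (hn : 3 ≤ n) (hcard : Fintype.card V = n)
    (hno : ¬ ∃ g, CycN G n g) (hmax : ∀ H : SimpleGraph V, G < H → ∃ g, CycN H n g) :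
    ∃ f, HP G n f := by
  have : NeZero n := ⟨by omega⟩
  have hG : ∃ x y, x ≠ y ∧ ¬ G.Adj x y := by
    by_contra hcon
    push Not at hcon
    let e : V ≃ Fin n := Fintype.equivFinOfCardEq hcard
    have hinj : ∀ i j, i < n → j < n → e.symm (Fin.ofNat n i) = e.symm (Fin.ofNat n j) →
        i = j := by
      intro i j hi hj hij
      have := congrArg Fin.val (e.symm.injective hij)
      simpa [Fin.ofNat, Nat.mod_eq_of_lt hi, Nat.mod_eq_of_lt hj] using this
    refine hno ⟨fun i => e.symm (Fin.ofNat n i), ⟨hinj, fun i hi => ?_⟩, ?_⟩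
    · refine hcon _ _ (fun h => ?_)
      have := hinj _ _ (by omega) hi h
      omega
    · refine hcon _ _ (fun h => ?_)
      have := hinj _ _ (by omega) (by omega) h
      omega
  obtain ⟨x, y, hxy, hnadj⟩ := hG
  have hlt : G < G ⊔ edge x y := by
    refine lt_of_le_of_ne le_sup_left (fun e => hnadj ?_)
    rw [e]
    simp [edge_adj, hxy]
  obtain ⟨g, hg⟩ := hmax _ hlt
  have hadjH : ∀ u v, (G ⊔ edge x y).Adj u v → G.Adj u v ∨ (u = x ∧ v = y) ∨ (u = y ∧ v = x) := by
    intro u v h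
    simp only [sup_adj, edge_adj] at h
    tauto
  have hz := cyc_toZ (by omega) hg
  generalize (fun a : ZMod n => g a.val) = c at hz
  by_cases hall : ∀ s, G.Adj (c s) (c (s + 1))
  · exact ⟨_, Zpath (G := G) ⟨hz.1, hall⟩ 0⟩
  · push Not at hall
    obtain ⟨s, hs⟩ := hall
    have hp := Zpath hz (s + 1)
    refine ⟨_, hp.1, ?_⟩
    intro i hi
    have h1 := hadjH _ _ (hp.2 i hi)
    have h2 := hadjH _ _ (hz.2 s)
    have key : ∀ a b : ℕ, a < n → b < n → c (s + 1 + a) = c (s + 1 + b) → a = b :=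
      fun a b => hp.1 a b
    have es : c s = c (s + 1 + (n - 1 : ℕ)) := by
      rw [castpred (by omega), add_neg_cancel_right]
    have es' : c (s + 1) = c (s + 1 + (0 : ℕ)) := by simp
    rw [es, es'] at h2 hs
    rcases h1 with h1 | h1 | h1
    · exact h1
    all_goals
      rcases h2 with h2 | h2 | h2
      · exact absurd h2 hs
      · have k1 := key (n - 1) i (by omega) (by omega)
        have k2 := key (n - 1) (i + 1) (by omega) (by omega)
        have k3 := key 0 i (by omega) (by omega)
        have k4 := key 0 (i + 1) (by omega) (by omega)
        simp only [h1.1, h1.2, h2.1, h2.2, forall_const] at k1 k2 k3 k4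
        omega
      · have k1 := key (n - 1) i (by omega) (by omega)
        have k2 := key (n - 1) (i + 1) (by omega) (by omega)
        have k3 := key 0 i (by omega) (by omega)
        have k4 := key 0 (i + 1) (by omega) (by omega)
        simp only [h1.1, h1.2, h2.1, h2.2, forall_const] at k1 k2 k3 k4
        omega

end cycles

lemma deg_mono {V : Type} [Fintype V] {G H : SimpleGraph V} (h : G ≤ H) (v : V) :
    deg G v ≤ deg H v :=
  Set.ncard_le_ncard (fun _ hw => h hw) (Set.toFinite _)

/-- Structure of non-Hamiltonian graphs with `δ(G) ≥ n/2 - 1`, `n` even and large: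
a spanning subgraph of `K₁ ∨ (K_{n/2-1} ∪ K_{n/2})` or of `(K₂ ∪ (n/2-1)K₁) ∨ K_{n/2-1}`. -/
theorem stmt_12 :
    ∃ n₀ : ℕ, ∀ n : ℕ, n₀ ≤ n → Even n →
      ∀ (V : Type) [Fintype V] [DecidableEq V] (G : SimpleGraph V),
        Fintype.card V = n →
        (∀ v, n - 2 ≤ 2 * deg G v) →
        (¬ ∃ (v : V) (p : G.Walk v v), p.IsHamiltonianCycle) →
        ((∃ (u : V) (A B : Set V), Disjoint A B ∧ A ∪ B = Set.univ \ {u} ∧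
            A.ncard = n / 2 - 1 ∧ B.ncard = n / 2 ∧
            ∀ x y, G.Adj x y →
              (x = u ∨ y = u ∨ (x ∈ A ∧ y ∈ A) ∨ (x ∈ B ∧ y ∈ B)))
          ∨ (∃ (W : Set V) (a b : V), W.ncard = n / 2 - 1 ∧ a ≠ b ∧ a ∉ W ∧ b ∉ W ∧
              ∀ x y, G.Adj x y →
                (x ∈ W ∨ y ∈ W ∨ (x = a ∧ y = b) ∨ (x = b ∧ y = a)))) := by
  refine ⟨14, ?_⟩
  intro n hn heven V _ _ G hcard hdeg hham
  obtain ⟨k, rfl⟩ := heven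
  have e2 : k + k = 2 * k := by ring
  rw [e2] at hcard hdeg hn ⊢
  have hno : ¬ ∃ g, CycN G (2 * k) g := by
    rintro ⟨g, hg⟩
    exact hham (ham_of_cyc hcard (by omega) hg)
  obtain ⟨H, hGH, hH⟩ := (Set.toFinite {H : SimpleGraph V | ¬ ∃ g, CycN H (2 * k) g}).exists_le_maximal
    (a := G) hno
  have hdeg' : ∀ v, k ≤ deg H v + 1 := by
    intro v
    have := deg_mono hGH v
    have := hdeg v
    omega
  have hmax : ∀ K : SimpleGraph V, H < K → ∃ g, CycN K (2 * k) g := by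
    intro K hK
    by_contra hcon
    exact hH.not_gt hcon hK
  obtain ⟨f, hf⟩ := exists_path (by omega) hcard hH.prop hmax
  rcases main_path (by omega) hcard hdeg' hH.prop hf with h | h
  · left
    obtain ⟨u, A, B, h1, h2, h3, h4, h5⟩ := h
    exact ⟨u, A, B, h1, h2, h3, h4, fun x y hxy => h5 x y (hGH hxy)⟩
  · right
    obtain ⟨W, a, b, h1, h2, h3, h4, h5⟩ := h
    exact ⟨W, a, b, h1, h2, h3, h4, fun x y hxy => h5 x y (hGH hxy)⟩
end
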